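/- Let T be a complete first-order theory with infinite models in a countable language L. Suppose T admits an infinite definable discrete linear order; that is, there exist an ℵ₀-saturated model M of T, an integer n ≥ 1, L-formulas δ(x̄,z̄) and φ(x̄,ȳ,z̄), and a parameter tuple c̄ from M such that the set D = δ(Mⁿ,c̄) is infinite and the relation defined by φ(x̄,ȳ,c̄) is a linear order on D which is discrete. Then T has exactly 2^ℵ₀ countably infinite models up to isomorphism. -/

import Mathlib

open FirstOrder FirstOrder.Language Set Cardinal

universe u v w

namespace PaperDef

variable {L : FirstOrder.Language.{u, v}}

/-- Valuation assigning parameters from `A` their own values and the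
`n` free variables the values given by the tuple `x`. -/
def pval {M : Type w} {A : Set M} {n : ℕ} (x : Fin n → M) : ↥A ⊕ Fin n → M :=
  Sum.elim Subtype.val x

variable {M : Type w} [L.Structure M]

/-- The subset of `M` defined by an `L(A)`-formula in one free variable. -/
def defSet (A : Set M) (δ : L.Formula (↥A ⊕ Fin 1)) : Set M :=
  {a | δ.Realize (pval ![a])}

/-- The binary relation on `M` defined by an `L(A)`-formula in two free variables. -/
def defRel (A : Set M) (φ : L.Formula (↥A ⊕ Fin 2)) : M → M → Prop :=
  fun a b => φ.Realize (pval ![a, b])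

/-- The relation defined by `φ`, guarded so as to only hold on the set defined by `δ`
(the paper's convention of writing `x < y` for `x ∈ D ∧ y ∈ D ∧ x < y`). -/
def gRel (A : Set M) (δ : L.Formula (↥A ⊕ Fin 1)) (φ : L.Formula (↥A ⊕ Fin 2)) :
    M → M → Prop :=
  fun a b => a ∈ defSet A δ ∧ b ∈ defSet A δ ∧ defRel A φ a b

/-- The set of realizations in `M` of a set of `L(A)`-formulas in one free variable. -/
def typeSet (A : Set M) (p : Set (L.Formula (↥A ⊕ Fin 1))) : Set M :=
  {a | ∀ φ ∈ p, φ.Realize (pval ![a])}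

/-- A set of `L(A)`-formulas in `n` free variables is finitely satisfiable in `M`. -/
def FinSat (A : Set M) {n : ℕ} (p : Set (L.Formula (↥A ⊕ Fin n))) : Prop :=
  ∀ s : Finset (L.Formula (↥A ⊕ Fin n)), ↑s ⊆ p →
    ∃ x : Fin n → M, ∀ φ ∈ s, Formula.Realize φ (pval x)

/-- A complete `n`-type over `A` (relative to the complete theory of `M` with
parameters in `A`): a maximal finitely satisfiable set of formulas. -/
def IsCompleteType (A : Set M) {n : ℕ} (p : Set (L.Formula (↥A ⊕ Fin n))) : Prop :=
  FinSat A p ∧ ∀ φ : L.Formula (↥A ⊕ Fin n), φ ∈ p ∨ BoundedFormula.not φ ∈ p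

/-- `M` is ℵ₀-saturated: every finitely satisfiable set of formulas in one free
variable with parameters from a finite subset of `M` is realized in `M`. -/
def IsAleph0Saturated (L : FirstOrder.Language.{u, v}) (M : Type w) [L.Structure M] : Prop :=
  ∀ A : Set M, A.Finite → ∀ p : Set (L.Formula (↥A ⊕ Fin 1)),
    FinSat A p → (typeSet A p).Nonempty

/-- `M` is ℵ₁-saturated: every finitely satisfiable set of formulas in one free
variable with parameters from a countable subset of `M` is realized in `M`. -/
def IsAleph1Saturated (L : FirstOrder.Language.{u, v}) (M : Type w) [L.Structure M] : Prop :=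
  ∀ A : Set M, A.Countable → ∀ p : Set (L.Formula (↥A ⊕ Fin 1)),
    FinSat A p → (typeSet A p).Nonempty

/-- The definable closure of `A` in `M`. -/
def dclSet (L : FirstOrder.Language.{u, v}) {M : Type w} [L.Structure M] (A : Set M) : Set M :=
  {a | ∃ φ : L.Formula (↥A ⊕ Fin 1),
    φ.Realize (pval ![a]) ∧ ∀ b : M, φ.Realize (pval ![b]) → b = a}

/-- `r` is a (strict) linear order on the set `D`. -/
def IsLinearOn {X : Type*} (r : X → X → Prop) (D : Set X) : Prop :=
  (∀ a ∈ D, ¬r a a) ∧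
  (∀ a ∈ D, ∀ b ∈ D, ∀ c ∈ D, r a b → r b c → r a c) ∧
  (∀ a ∈ D, ∀ b ∈ D, a = b ∨ r a b ∨ r b a)

/-- The linear order `r` on `D` is discrete: every element other than the maximum
has an immediate successor and every element other than the minimum has an
immediate predecessor. -/
def IsDiscreteOn {X : Type*} (r : X → X → Prop) (D : Set X) : Prop :=
  (∀ a ∈ D, (∃ b ∈ D, r a b) → ∃ b ∈ D, r a b ∧ ∀ c ∈ D, r a c → c = b ∨ r b c) ∧
  (∀ a ∈ D, (∃ b ∈ D, r b a) → ∃ b ∈ D, r b a ∧ ∀ c ∈ D, r c a → c = b ∨ r c b)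

/-- `C` is an initial part of the order `(D, r)`. -/
def IsInitialPart {X : Type*} (r : X → X → Prop) (D C : Set X) : Prop :=
  C ⊆ D ∧ ∀ c ∈ C, ∀ d ∈ D, r d c → d ∈ C

/-- `(C, r)` has order type ω: `C` is infinite and every element has only
finitely many predecessors in `C`. -/
def HasOrderTypeOmega {X : Type*} (r : X → X → Prop) (C : Set X) : Prop :=
  C.Infinite ∧ ∀ c ∈ C, {c' ∈ C | r c' c}.Finite

/-- `p` is a simple type over `A`, witnessed by `C ⊆ dcl(A)` and the `A`-definable
linear order `(D, <)` given by the formulas `δ` (defining `D`) and `lt` (defining `<`). -/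
def IsSimpleWitness (A : Set M) (p : Set (L.Formula (↥A ⊕ Fin 1))) (C : Set M)
    (δ : L.Formula (↥A ⊕ Fin 1)) (lt : L.Formula (↥A ⊕ Fin 2)) : Prop :=
  IsCompleteType A p ∧
  C.Infinite ∧
  C ⊆ dclSet L A ∧
  IsLinearOn (gRel A δ lt) (defSet A δ) ∧
  IsInitialPart (gRel A δ lt) (defSet A δ) C ∧
  HasOrderTypeOmega (gRel A δ lt) C ∧
  ∀ φ : L.Formula (↥A ⊕ Fin 1),
    φ ∈ p ↔ {c ∈ C | ¬φ.Realize (pval ![c])}.Finite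

/-- `b` is the immediate successor of `a` in the order `(P, r)`. -/
def SuccIn {X : Type*} (r : X → X → Prop) (P : Set X) (a b : X) : Prop :=
  a ∈ P ∧ b ∈ P ∧ r a b ∧ ∀ c ∈ P, r a c → c = b ∨ r b c

/-- `zIter S k a b` says that `b = Sᵏ(a)`, where negative iterates of `S` are
interpreted via the (partial) inverse of `S`. -/
def zIter {X : Type*} (S : X → X) (k : ℤ) (a b : X) : Prop :=
  if 0 ≤ k then S^[k.toNat] a = b else S^[(-k).toNat] b = a

/-- Isomorphism as an equivalence relation on countably infinite models of `T`
(with underlying set in `Type 0`). -/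
def countableModelSetoid (T : L.Theory) :
    Setoid {N : Theory.ModelType.{u, v, 0} T // Countable N ∧ Infinite N} where
  r N₁ N₂ := Nonempty (N₁.1 ≃[L] N₂.1)
  iseqv := ⟨fun N => ⟨FirstOrder.Language.Equiv.refl L N.1⟩,
    fun e => e.map FirstOrder.Language.Equiv.symm,
    fun e f => Nonempty.map2 (fun i j => j.comp i) e f⟩

/-- The number of countably infinite models of `T` up to isomorphism. -/
noncomputable def numCountableModels (T : L.Theory) : Cardinal :=
  #(Quotient (countableModelSetoid T))

end PaperDef

open Set

namespace PaperDef

/-- An abstract system of trace relations on the natural numbers. -/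
structure TrSys where
  Tr : ∀ X : Type, ((X → ℕ) → Prop) → Prop
  and' : ∀ {X : Type} {R S : (X → ℕ) → Prop}, Tr X R → Tr X S → Tr X (fun w => R w ∧ S w)
  not' : ∀ {X : Type} {R : (X → ℕ) → Prop}, Tr X R → Tr X (fun w => ¬ R w)
  lt' : Tr (Fin 2) (fun w => w 0 < w 1)
  pre : ∀ {X Y : Type} {R : (X → ℕ) → Prop} (f : X → Y), Tr X R → Tr Y (fun w => R (w ∘ f))
  bex : ∀ {X Y : Type} [Finite Y] {R : (X ⊕ Y → ℕ) → Prop} (i : X), Tr (X ⊕ Y) R →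
    Tr X (fun w => ∃ t : Y → ℕ, (∀ j, t j ≤ w i) ∧ R (Sum.elim w t))
  simple : ∀ {R : (Unit → ℕ) → Prop}, Tr Unit R →
    ∃ k, (∀ z, k ≤ z → R (fun _ => z)) ∨ (∀ z, k ≤ z → ¬ R (fun _ => z))

namespace TrSys

variable (T : TrSys)

theorem congr {X : Type} {R S : (X → ℕ) → Prop} (h : T.Tr X R) (e : ∀ w, R w ↔ S w) :
    T.Tr X S := by
  have : R = S := funext fun w => propext (e w)
  exact this ▸ h

theorem or' {X : Type} {R S : (X → ℕ) → Prop} (h : T.Tr X R) (h' : T.Tr X S) :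
    T.Tr X (fun w => R w ∨ S w) :=
  T.congr (T.not' (T.and' (T.not' h) (T.not' h'))) (fun w => by tauto)

theorem xor' {X : Type} {R S : (X → ℕ) → Prop} (h : T.Tr X R) (h' : T.Tr X S) :
    T.Tr X (fun w => ¬ (R w ↔ S w)) :=
  T.congr (T.or' (T.and' h (T.not' h')) (T.and' (T.not' h) h')) (fun w => by tauto)

/-- binary relations -/
def Tr2 (B : ℕ → ℕ → Prop) : Prop := T.Tr (Fin 2) (fun w => B (w 0) (w 1))

variable {T}

theorem Tr2.app {B : ℕ → ℕ → Prop} (h : T.Tr2 B) {X : Type} (i j : X) :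
    T.Tr X (fun w => B (w i) (w j)) :=
  T.congr (T.pre (Y := X) ![i, j] h) (fun w => by simp)

variable (T)

theorem lt2 : T.Tr2 (· < ·) := T.lt'

theorem eq2 : T.Tr2 (· = ·) :=
  T.congr (T.and' (T.not' (T.lt2.app (0 : Fin 2) 1)) (T.not' (T.lt2.app (1 : Fin 2) 0)))
    (fun w => by omega)

theorem succ2 : T.Tr2 (fun a b => a + 1 = b) := by
  have h : T.Tr (Fin 2 ⊕ Unit) (fun w => w (.inl 0) < w (.inr ()) ∧ w (.inr ()) < w (.inl 1)) :=
    T.and' (T.lt2.app _ _) (T.lt2.app _ _)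
  have h2 := T.and' (T.lt2.app (0 : Fin 2) 1) (T.not' (T.bex (1 : Fin 2) h))
  refine T.congr h2 (fun w => ?_)
  simp only [Sum.elim_inl, Sum.elim_inr]
  constructor
  · rintro ⟨h1, h3⟩
    by_contra hne
    exact h3 ⟨fun _ => w 0 + 1, fun _ => by ((try dsimp only); omega), by ((try dsimp only); omega), by ((try dsimp only); omega)⟩
  · intro h1
    refine ⟨by omega, ?_⟩
    rintro ⟨t, -, h2, h3⟩
    omega

theorem add2 (k : ℕ) : T.Tr2 (fun a b => a + k = b) := by
  induction k with
  | zero => simpa using T.eq2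
  | succ k ih =>
    have h : T.Tr (Fin 2 ⊕ Unit) (fun w => w (.inl 0) + k = w (.inr ()) ∧
        w (.inr ()) + 1 = w (.inl 1)) :=
      T.and' (ih.app _ _) (T.succ2.app _ _)
    refine T.congr (T.bex (1 : Fin 2) h) (fun w => ?_)
    simp only [Sum.elim_inl, Sum.elim_inr]
    constructor
    · rintro ⟨t, -, h2, h3⟩
      omega
    · intro h1
      exact ⟨fun _ => w 0 + k, fun _ => by ((try dsimp only); omega), rfl, by ((try dsimp only); omega)⟩

theorem const1 (k : ℕ) {X : Type} (i : X) : T.Tr X (fun w => w i = k) := by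
  have h : T.Tr (X ⊕ Fin 2) (fun w => w (.inr 0) < w (.inr 1) ∧ w (.inr 0) + k = w (.inl i)) :=
    T.and' (T.lt2.app _ _) ((T.add2 k).app _ _)
  have h0 : T.Tr (X ⊕ Fin 2) (fun w => w (.inr 1) < w (.inr 0) ∧ w (.inr 1) + k = w (.inl i)) :=
    T.and' (T.lt2.app _ _) ((T.add2 k).app _ _)
  have hz : T.Tr (X ⊕ Unit) (fun w => w (.inr ()) < w (.inl i)) := T.lt2.app _ _
  have hzero : ∀ {Y : Type} (j : Y), T.Tr Y (fun w => w j = 0) := by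
    intro Y j
    have hz : T.Tr (Y ⊕ Unit) (fun w => w (.inr ()) < w (.inl j)) := T.lt2.app _ _
    refine T.congr (T.not' (T.bex j hz)) (fun w => ?_)
    simp only [Sum.elim_inl, Sum.elim_inr]
    constructor
    · intro h
      by_contra hne
      exact h ⟨fun _ => 0, fun _ => by ((try dsimp only); omega), by ((try dsimp only); omega)⟩
    · rintro h ⟨t, -, h2⟩
      omega
  have h : T.Tr (X ⊕ Unit) (fun w => w (.inr ()) = 0 ∧ w (.inr ()) + k = w (.inl i)) :=
    T.and' (hzero _) ((T.add2 k).app _ _)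
  refine T.congr (T.bex i h) (fun w => ?_)
  simp only [Sum.elim_inl, Sum.elim_inr]
  constructor
  · rintro ⟨t, -, h2, h3⟩
    omega
  · intro h1
    exact ⟨fun _ => 0, fun _ => by ((try dsimp only); omega), rfl, by ((try dsimp only); omega)⟩

theorem finAnd {X ι : Type} [Finite ι] {R : ι → (X → ℕ) → Prop} (h : ∀ i, T.Tr X (R i))
    (x0 : X) : T.Tr X (fun w => ∀ i, R i w) := by
  classical
  have := Fintype.ofFinite ι
  have key : ∀ s : Finset ι, T.Tr X (fun w => ∀ i ∈ s, R i w) := by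
    intro s
    induction s using Finset.induction_on with
    | empty =>
      refine T.congr (T.eq2.app x0 x0) (fun w => by simp)
    | insert a s ha ih =>
      refine T.congr (T.and' (h a) ih) (fun w => by simp)
  exact T.congr (key Finset.univ) (fun w => by simp)

/-- main gap lemma -/
theorem gap {Bad : ℕ → ℕ → Prop} (hB : T.Tr2 Bad)
    (hmono : ∀ y y' z, y ≤ y' → Bad y z → Bad y' z)
    (hfin : ∀ y, ∃ k, ∀ z, k ≤ z → ¬ Bad y z) :
    ∃ k, ∀ y z, y + k ≤ z → ¬ Bad y z := by
  classical
  have hE : T.Tr Unit (fun w => ∃ t : Unit → ℕ, (∀ j, t j ≤ w ()) ∧ Bad (t ()) (w ())) :=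
    T.bex (Y := Unit) (R := fun w => Bad (w (.inr ())) (w (.inl ()))) () (hB.app _ _)
  obtain ⟨z0, h0 | h0⟩ := T.simple hE
  swap
  · refine ⟨z0, fun y z hyz hbad => h0 z (by omega) ⟨fun _ => y, fun _ => by ((try dsimp only); omega), hbad⟩⟩
  have hex : ∀ z, z0 ≤ z → ∃ y, y ≤ z ∧ Bad y z := by
    intro z hz
    obtain ⟨t, ht, hb⟩ := h0 z hz
    exact ⟨t (), ht (), hb⟩
  -- graph of g
  let G : ℕ → ℕ → Prop := fun y z => Bad y z ∧ ∀ y', y' < y → ¬ Bad y' z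
  have hG : T.Tr2 G := by
    have h1 : T.Tr (Fin 2 ⊕ Unit) (fun w => w (.inr ()) < w (.inl 0) ∧
        Bad (w (.inr ())) (w (.inl 1))) := T.and' (T.lt2.app _ _) (hB.app _ _)
    refine T.congr (T.and' hB (T.not' (T.bex (0 : Fin 2) h1))) (fun w => ?_)
    simp only [Sum.elim_inl, Sum.elim_inr, G]
    refine and_congr_right fun _ => ⟨fun h y hy hb => ?_, fun h => ?_⟩
    · exact h ⟨fun _ => y, fun _ => by ((try dsimp only); omega), hy, hb⟩
    · rintro ⟨t, -, h2, h3⟩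
      exact h _ h2 h3
  have hg : ∃ g : ℕ → ℕ, ∀ z, z0 ≤ z → g z ≤ z ∧ G (g z) z := by
    refine ⟨fun z => sInf {y | Bad y z}, fun z hz => ?_⟩
    obtain ⟨y, hy, hb⟩ := hex z hz
    refine ⟨(Nat.sInf_le (s := {y | Bad y z}) hb).trans hy, Nat.sInf_mem (s := {y | Bad y z}) ⟨y, hb⟩, ?_⟩
    intro y' hy' hb'
    exact absurd (Nat.sInf_le (s := {y | Bad y z}) hb') (by dsimp only at hy'; omega)
  obtain ⟨g, hg⟩ := hg
  have huniq : ∀ y z, z0 ≤ z → G y z → y = g z := by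
    intro y z hz h
    rcases lt_trichotomy y (g z) with h1 | h1 | h1
    · exact absurd h.1 ((hg z hz).2.2 _ h1)
    · exact h1
    · exact absurd (hg z hz).2.1 (h.2 _ h1)
  -- S1 : g (z+1) > g z
  have hS1 : T.Tr (Unit ⊕ Fin 3) (fun w => w (.inr 0) + 1 = w (.inl ()) ∧
      G (w (.inr 1)) (w (.inl ())) ∧ G (w (.inr 2)) (w (.inr 0)) ∧ w (.inr 2) < w (.inr 1)) :=
    T.and' (T.succ2.app _ _) (T.and' (hG.app _ _) (T.and' (hG.app _ _) (T.lt2.app _ _)))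
  have hS2 : T.Tr (Unit ⊕ Fin 4) (fun w => w (.inr 0) + 1 = w (.inl ()) ∧
      G (w (.inr 1)) (w (.inl ())) ∧ G (w (.inr 2)) (w (.inr 0)) ∧ w (.inr 2) + 1 = w (.inr 3)
        ∧ w (.inr 3) < w (.inr 1)) :=
    T.and' (T.succ2.app _ _) (T.and' (hG.app _ _) (T.and' (hG.app _ _)
      (T.and' (T.succ2.app _ _) (T.lt2.app _ _))))
  obtain ⟨z1, h1⟩ := T.simple (T.bex () hS1)
  obtain ⟨z2, h2⟩ := T.simple (T.bex () hS2)
  simp only [Sum.elim_inl, Sum.elim_inr] at h1 h2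
  have k1 : (∀ z, z0 + z1 ≤ z → g z < g (z + 1)) ∨ (∀ z, z0 + z1 ≤ z → ¬ g z < g (z + 1)) := by
    rcases h1 with h1 | h1
    · left
      intro z hz
      obtain ⟨t, ht, e1, e2, e3, e4⟩ := h1 (z + 1) (by omega)
      have e0 : t 0 = z := by omega
      rw [e0] at e3
      rw [huniq _ _ (by omega) e2, huniq _ _ (by omega) e3] at e4
      exact e4
    · right
      intro z hz hlt
      refine h1 (z + 1) (by omega) ⟨![z, g (z+1), g z], ?_, ?_⟩
      · have := (hg z (by omega)).1
        have := (hg (z+1) (by omega)).1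
        intro j; fin_cases j <;> simp <;> omega
      · exact ⟨rfl, (hg _ (by omega)).2, (hg _ (by omega)).2, hlt⟩
  have k2 : (∀ z, z0 + z2 ≤ z → g z + 1 < g (z + 1)) ∨
      (∀ z, z0 + z2 ≤ z → ¬ g z + 1 < g (z + 1)) := by
    rcases h2 with h2 | h2
    · left
      intro z hz
      obtain ⟨t, ht, e1, e2, e3, e4, e5⟩ := h2 (z + 1) (by omega)
      have e0 : t 0 = z := by omega
      rw [e0] at e3
      rw [huniq _ _ (by omega) e3] at e4
      rw [huniq _ _ (by omega) e2] at e5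
      omega
    · right
      intro z hz hlt
      refine h2 (z + 1) (by omega) ⟨![z, g (z+1), g z, g z + 1], ?_, ?_⟩
      · have := (hg z (by omega)).1
        have := (hg (z+1) (by omega)).1
        intro j; fin_cases j <;> simp <;> omega
      · exact ⟨rfl, (hg _ (by omega)).2, (hg _ (by omega)).2, rfl, hlt⟩
  rcases k1 with k1 | k1
  swap
  · exfalso
    have hb : ∀ m, g (z0 + z1 + m) ≤ g (z0 + z1) := by
      intro m
      induction m with
      | zero => simp
      | succ m ih =>
        have := k1 (z0 + z1 + m) (by omega)
        have e : z0 + z1 + (m + 1) = z0 + z1 + m + 1 := by omega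
        rw [e]; omega
    obtain ⟨k, hk⟩ := hfin (g (z0 + z1))
    exact hk (z0 + z1 + k) (by omega) (hmono _ _ _ (hb k) (hg _ (by omega)).2.1)
  rcases k2 with k2 | k2
  · exfalso
    have hb : ∀ m, 2 * m ≤ g (z0 + z2 + m) := by
      intro m
      induction m with
      | zero => simp
      | succ m ih =>
        have := k2 (z0 + z2 + m) (by omega)
        have e : z0 + z2 + (m + 1) = z0 + z2 + m + 1 := by omega
        rw [e]; omega
    have a1 := hb (z0 + z2 + 1)
    have a2 := (hg (z0 + z2 + (z0 + z2 + 1)) (by omega)).1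
    omega
  · have hb : ∀ m, m ≤ g (z0 + z1 + m) := by
      intro m
      induction m with
      | zero => simp
      | succ m ih =>
        have := k1 (z0 + z1 + m) (by omega)
        have e : z0 + z1 + (m + 1) = z0 + z1 + m + 1 := by omega
        rw [e]; omega
    refine ⟨z0 + z1 + 1, fun y z hyz hbad => ?_⟩
    have a1 := hb (z - (z0 + z1))
    have e : z0 + z1 + (z - (z0 + z1)) = z := by omega
    rw [e] at a1
    exact (hg z (by omega)).2.2 y (by omega) hbad

/-- separated tuples -/
def Sep (k : ℕ) {n : ℕ} (y : Fin n → ℕ) : Prop :=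
  (∀ i, k < y i) ∧ ∀ i j, i < j → y i + k < y j

theorem homog : ∀ (n : ℕ) (R : (Fin n → ℕ) → Prop), T.Tr (Fin n) R →
    ∃ k, (∀ y, Sep k y → R y) ∨ (∀ y, Sep k y → ¬ R y)
  | 0, R, _ => by
    refine ⟨0, ?_⟩
    by_cases h : R default
    · left; intro y _; rwa [Subsingleton.elim y default]
    · right; intro y _; rwa [Subsingleton.elim y default]
  | 1, R, hR => by
    obtain ⟨k, hk⟩ := T.simple (T.pre (Y := Unit) (fun _ => ()) hR)
    refine ⟨k, hk.imp (fun h y hy => ?_) (fun h y hy => ?_)⟩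
    all_goals
      have := h (y 0) (hy.1 0).le
      convert this using 2
      ext i
      simp [Subsingleton.elim i 0]
  | n + 2, R, hR => by
    -- Q x z
    let Q : (Fin (n + 1) → ℕ) → ℕ → Prop := fun x z => R (Fin.snoc x z)
    have hQ : ∀ {X : Type} (f : Fin (n + 1) → X) (i : X),
        T.Tr X (fun w => Q (w ∘ f) (w i)) := by
      intro X f i
      refine T.congr (T.pre (Y := X) (Fin.snoc f i : Fin (n + 2) → X) hR) (fun w => ?_)
      have : w ∘ (Fin.snoc f i : Fin (n + 2) → X) = Fin.snoc (w ∘ f) (w i) := by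
        rw [Fin.comp_snoc]
      simp only [Q, this]
    let Bad : ℕ → ℕ → Prop := fun y z => ∃ x : Fin (n + 1) → ℕ, (∀ j, x j ≤ y) ∧
      ∃ z', z' + 1 = z ∧ ¬ (Q x z ↔ Q x z')
    have hBad : T.Tr2 Bad := by
      have h1 : T.Tr ((Fin 2 ⊕ Fin (n + 1)) ⊕ Unit) (fun w => w (.inr ()) + 1 = w (.inl (.inl 1)) ∧
          ¬ (Q (w ∘ (fun j => .inl (.inr j))) (w (.inl (.inl 1))) ↔
            Q (w ∘ (fun j => .inl (.inr j))) (w (.inr ())))) :=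
        T.and' (T.succ2.app _ _) (T.xor' (hQ _ _) (hQ _ _))
      have h2 := T.bex (.inl 1) h1
      have h3 := T.bex (0 : Fin 2) h2
      refine T.congr h3 (fun w => ?_)
      simp only [Bad]
      refine exists_congr fun x => and_congr_right fun _ => ?_
      constructor
      · rintro ⟨t, -, h4, h5⟩
        exact ⟨t (), h4, h5⟩
      · rintro ⟨z', h4, h5⟩
        refine ⟨fun _ => z', fun _ => ?_, h4, h5⟩
        simp only [Sum.elim_inl]; omega
    have hone : ∀ x : Fin (n + 1) → ℕ, ∃ k, ∀ z, k ≤ z → (Q x z ↔ Q x (z + 1)) := by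
      intro x
      have h1 : T.Tr (Unit ⊕ Fin (n + 1)) (fun w => (∀ j, w (.inr j) = x j) ∧
          Q (w ∘ Sum.inr) (w (.inl ()))) :=
        T.and' (T.finAnd (fun j => T.const1 _ _) (.inl ())) (hQ _ _)
      obtain ⟨k, hk⟩ := T.simple (T.bex () h1)
      have hval : ∀ z, (∀ j, x j ≤ z) → ((∃ t : Fin (n + 1) → ℕ, (∀ j, t j ≤ z) ∧
          (∀ j, t j = x j) ∧ Q t z) ↔ Q x z) := by
        intro z hz
        constructor
        · rintro ⟨t, -, h3, h4⟩
          rwa [← (funext h3 : t = x)]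
        · intro h
          exact ⟨x, hz, fun _ => rfl, h⟩
      refine ⟨k + ∑ j, x j, fun z hz => ?_⟩
      have hx : ∀ j, x j ≤ z := fun j =>
        (Finset.single_le_sum (f := x) (fun _ _ => Nat.zero_le _) (Finset.mem_univ j)).trans
          (by omega)
      have hx1 : ∀ j, x j ≤ z + 1 := fun j => (hx j).trans (by omega)
      rcases hk with hk | hk
      · have a := (hval z hx).1 (hk z (by omega))
        have b := (hval (z + 1) hx1).1 (hk (z + 1) (by omega))
        tauto
      · have a := fun h => hk z (by omega) ((hval z hx).2 h)
        have b := fun h => hk (z + 1) (by omega) ((hval (z + 1) hx1).2 h)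
        tauto
    obtain ⟨k, hk⟩ := T.gap hBad (fun y y' z h => by
        rintro ⟨x, hx, h2⟩
        exact ⟨x, fun j => (hx j).trans h, h2⟩) (fun y => by
        choose K hK using hone
        have hfin : {x : Fin (n + 1) → ℕ | ∀ j, x j ≤ y}.Finite := by
          have : {x : Fin (n + 1) → ℕ | ∀ j, x j ≤ y} = Set.Iic (fun _ => y) := by
            ext x; simp [Pi.le_def]
          rw [this]; exact Set.finite_Iic _
        obtain ⟨B, hB⟩ := (hfin.image K).bddAbove
        refine ⟨B + 1, ?_⟩
        rintro z hz ⟨x, hx, z', rfl, h2⟩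
        have : K x ≤ B := hB ⟨x, hx, rfl⟩
        exact h2 (hK x z' (by omega)).symm)
    have hstab : ∀ (x : Fin (n + 1) → ℕ) (y : ℕ), (∀ j, x j ≤ y) → ∀ m,
        (Q x (y + k + m) ↔ Q x (y + k)) := by
      intro x y hx m
      induction m with
      | zero => rfl
      | succ m ih =>
        rw [← ih]
        by_contra hne
        exact hk y (y + k + (m + 1)) (by omega) ⟨x, hx, y + k + m, by omega, hne⟩
    let R' : (Fin (n + 1) → ℕ) → Prop := fun w => ∃ x : Fin (n + 1) → ℕ,
      (∀ j, x j ≤ w (Fin.last n)) ∧ (∀ j : Fin n, x j.castSucc = w j.castSucc) ∧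
        x (Fin.last n) + k = w (Fin.last n) ∧ Q x (w (Fin.last n))
    have hR' : T.Tr (Fin (n + 1)) R' := by
      have h1 : T.Tr (Fin (n + 1) ⊕ Fin (n + 1)) (fun w =>
          (∀ j : Fin n, w (.inr j.castSucc) = w (.inl j.castSucc)) ∧
          w (.inr (Fin.last n)) + k = w (.inl (Fin.last n)) ∧
          Q (w ∘ Sum.inr) (w (.inl (Fin.last n)))) :=
        T.and' (T.finAnd (fun j => T.eq2.app _ _) (.inl (Fin.last n)))
          (T.and' ((T.add2 k).app _ _) (hQ _ _))
      exact T.bex (Fin.last n) h1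
    obtain ⟨k', hk'⟩ := homog (n + 1) R' hR'
    have hred : ∀ y : Fin (n + 2) → ℕ, Sep (k + k') y → ∃ w : Fin (n + 1) → ℕ,
        Sep k' w ∧ (R' w ↔ R y) := by
      intro y hy
      let x : Fin (n + 1) → ℕ := fun j => y j.castSucc
      let w : Fin (n + 1) → ℕ := Fin.snoc (fun j : Fin n => x j.castSucc) (x (Fin.last n) + k)
      have hwl : w (Fin.last n) = x (Fin.last n) + k := by simp [w]
      have hwc : ∀ j : Fin n, w j.castSucc = x j.castSucc := fun j => by simp [w]
      have hxle : ∀ j, x j ≤ x (Fin.last n) := by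
        intro j
        rcases (Fin.le_last j).lt_or_eq with h | h
        · have := hy.2 j.castSucc (Fin.last n).castSucc (by simpa using h)
          simp only [x]; omega
        · rw [h]
      refine ⟨w, ⟨?_, ?_⟩, ?_⟩
      · intro i
        refine Fin.lastCases ?_ (fun j => ?_) i
        · have := hy.1 (Fin.last n).castSucc
          rw [hwl]; simp only [x]; omega
        · have := hy.1 j.castSucc.castSucc
          rw [hwc]; simp only [x]; omega
      · intro i j hij
        have hi : ∃ i' : Fin n, i = i'.castSucc := by
          refine ⟨i.castPred (fun h => ?_), by simp⟩
          subst h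
          exact absurd (Fin.le_last j) (not_le.2 hij)
        obtain ⟨i', rfl⟩ := hi
        have h1 : x i'.castSucc + (k + k') < x j :=
          hy.2 i'.castSucc.castSucc j.castSucc (by simpa using hij)
        rw [hwc]
        have h2 : x j ≤ w j := by
          refine Fin.lastCases ?_ (fun j => ?_) j
          · rw [hwl]; omega
          · rw [hwc]
        omega
      · have hRy : R y ↔ Q x (y (Fin.last (n + 1))) := by
          simp only [Q]
          have : (Fin.snoc x (y (Fin.last (n + 1))) : Fin (n + 2) → ℕ) = y := by
            exact Fin.snoc_init_self y
          rw [this]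
        have hlt := hy.2 (Fin.last n).castSucc (Fin.last (n + 1)) (by simp [Fin.lt_def])
        have hst := hstab x (x (Fin.last n)) hxle (y (Fin.last (n + 1)) - (x (Fin.last n) + k))
        have e : x (Fin.last n) + k + (y (Fin.last (n + 1)) - (x (Fin.last n) + k)) =
          y (Fin.last (n + 1)) := by simp only [x]; omega
        rw [e] at hst
        rw [hRy, hst]
        constructor
        · rintro ⟨x', -, h2, h3, h4⟩
          have : x' = x := by
            ext i
            refine Fin.lastCases ?_ (fun j => ?_) i
            · rw [hwl] at h3; omega
            · rw [h2, hwc]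
          rwa [this, hwl] at h4
        · intro h
          refine ⟨x, fun j => ?_, fun j => (hwc j).symm, hwl.symm, by rwa [hwl]⟩
          rw [hwl]; exact (hxle j).trans (by omega)
    refine ⟨k + k', hk'.imp (fun h y hy => ?_) (fun h y hy => ?_)⟩
    · obtain ⟨w, h1, h2⟩ := hred y hy
      exact h2.1 (h w h1)
    · obtain ⟨w, h1, h2⟩ := hred y hy
      exact fun h3 => h w h1 (h2.2 h3)

end TrSys

end PaperDef

namespace PaperDef

theorem support_exists {L : FirstOrder.Language.{u, v}} {α : Type} (φ : L.Formula α) :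
    ∃ s : Finset α, ∀ (N : Type w) [L.Structure N] (x y : α → N), (∀ i ∈ s, x i = y i) →
      (φ.Realize x ↔ φ.Realize y) := by
  classical
  refine ⟨φ.freeVarFinset, fun N _ x y h => ?_⟩
  have h1 := BoundedFormula.realize_restrictFreeVar (M := N) (φ := φ) (f := id)
    (v := fun i => x i) (xs := default) x (fun _ => rfl)
  have h2 := BoundedFormula.realize_restrictFreeVar (M := N) (φ := φ) (f := id)
    (v := fun i => y i) (xs := default) y (fun _ => rfl)
  have h3 : (fun i : φ.freeVarFinset => x i) = fun i : φ.freeVarFinset => y i := funext fun i => h i i.2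
  unfold Formula.Realize
  rw [← h1, ← h2, h3]

theorem ext_lemma {L : FirstOrder.Language.{u, v}} {M : Type w} [L.Structure M] [Nonempty M]
    {κ : Type} (Γ : Set (L.Formula κ))
    (h : ∀ F : Finset (L.Formula κ), (F : Set (L.Formula κ)) ⊆ Γ →
      ∃ x : κ → M, ∀ φ ∈ F, φ.Realize x) :
    ∃ (N : Type (max u v)) (_ : L.Structure N) (_ : Nonempty N) (x : κ → N),
      ∀ φ ∈ Γ, φ.Realize x := by
  classical
  let T : L[[κ]].Theory := Formula.equivSentence '' Γ
  have hT : T.IsSatisfiable := by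
    rw [Theory.isSatisfiable_iff_isFinitelySatisfiable]
    intro F hF
    obtain ⟨x, hx⟩ := h (F.image Formula.equivSentence.symm) (by
      intro φ hφ
      simp only [Finset.coe_image, Set.mem_image, Finset.mem_coe] at hφ
      obtain ⟨ψ, hψ, rfl⟩ := hφ
      obtain ⟨χ, hχ, e⟩ := hF hψ
      rw [← e]; simpa using hχ)
    let := constantsOn.structure x
    have : M ⊨ (F : L[[κ]].Theory) := by
      refine ⟨fun φ hφ => ?_⟩
      have := hx (Formula.equivSentence.symm φ) (Finset.mem_image_of_mem _ hφ)
      exact (Formula.realize_equivSentence_symm M φ x).1 this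
    exact Theory.Model.isSatisfiable M
  obtain ⟨N⟩ := hT
  let : L.Structure N := (L.lhomWithConstants κ).reduct N
  have : (L.lhomWithConstants κ).IsExpansionOn N := LHom.isExpansionOn_reduct _ _
  refine ⟨N, inferInstance, inferInstance, fun a => (L.con a : N), fun φ hφ => ?_⟩
  rw [← Formula.realize_equivSentence]
  exact Theory.realize_sentence_of_mem T ⟨φ, hφ, rfl⟩

theorem countable_formula {L : FirstOrder.Language.{u, v}} (hL : L.card ≤ ℵ₀) (α : Type)
    [Countable α] : Countable (L.Formula α) := by
  have h := BoundedFormula.card_le (L := L) (α := α)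
  have h2 : #(Σ n, L.BoundedFormula α n) ≤ ℵ₀ := by
    refine h.trans (max_le le_rfl ?_)
    exact Cardinal.add_le_aleph0.2 ⟨by simp, by simpa using hL⟩
  rw [Cardinal.mk_le_aleph0_iff] at h2
  exact Function.Injective.countable (f := fun φ : L.Formula α => (⟨0, φ⟩ : Σ n, L.BoundedFormula α n))
    (fun a b e => by simpa using e)

section avoid_sec

variable {L : FirstOrder.Language.{u, v}} {M : Type w} [L.Structure M]
  {κ : Type} (a : κ → M)

/-- forcing conditions -/
def Cond : Type (max u v) := {σ : L.Formula (κ ⊕ ℕ) // ∃ e : ℕ → M, σ.Realize (Sum.elim a e)}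

instance : Preorder (Cond (L := L) a) where
  le σ τ := ∀ e : ℕ → M, τ.1.Realize (Sum.elim a e) → σ.1.Realize (Sum.elim a e)
  le_refl _ _ h := h
  le_trans _ _ _ h1 h2 e h := h1 e (h2 e h)

theorem avoid_pre (hL : L.card ≤ ℵ₀) [Nonempty M] [Countable κ] {d : ℕ}
    (q : Set (L.Formula (κ ⊕ Fin d)))
    (hq : ∀ θ : L.Formula (κ ⊕ Fin d), (∃ x, θ.Realize (Sum.elim a x)) →
      ∃ ψ ∈ q, ∃ x, θ.Realize (Sum.elim a x) ∧ ¬ ψ.Realize (Sum.elim a x)) :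
    ∃ (N : Type (max u v)) (_ : L.Structure N) (_ : Nonempty N) (x : κ ⊕ ℕ → N),
      (∀ σ : L.Formula κ, σ.Realize a ↔ σ.Realize (x ∘ Sum.inl)) ∧
      (∀ τ : L.Formula ((κ ⊕ ℕ) ⊕ Unit), (∃ y, τ.Realize (Sum.elim x (fun _ => y))) →
        ∃ k : ℕ, τ.Realize (Sum.elim x (fun _ => x (Sum.inr k)))) ∧
      (∀ t : Fin d → κ ⊕ ℕ, ∃ ψ ∈ q, ¬ ψ.Realize (Sum.elim (x ∘ Sum.inl) (x ∘ t))) := by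
  classical
  have := countable_formula hL ((κ ⊕ ℕ) ⊕ Unit)
  let A : L.Formula ((κ ⊕ ℕ) ⊕ Unit) → Order.Cofinal (Cond (L := L) a) := fun τ =>
    { carrier := {σ | (∀ e : ℕ → M, σ.1.Realize (Sum.elim a e) →
          ¬ ∃ y, τ.Realize (Sum.elim (Sum.elim a e) (fun _ => y))) ∨
          ∃ k : ℕ, ∀ e : ℕ → M, σ.1.Realize (Sum.elim a e) →
            τ.Realize (Sum.elim (Sum.elim a e) (fun _ => e k))}
      isCofinal := by
        intro σ
        let τ' : L.Formula (κ ⊕ ℕ) := τ.iExs Unit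
        have hτ' : ∀ e : ℕ → M, τ'.Realize (Sum.elim a e) ↔
            ∃ y, τ.Realize (Sum.elim (Sum.elim a e) (fun _ => y)) := by
          intro e
          simp only [τ', Formula.realize_iExs]
          exact ⟨fun ⟨i, hi⟩ => ⟨i (), hi⟩, fun ⟨y, hy⟩ => ⟨fun _ => y, hy⟩⟩
        by_cases h : ∃ e : ℕ → M, (σ.1 ⊓ τ'.not).Realize (Sum.elim a e)
        · refine ⟨⟨σ.1 ⊓ τ'.not, h⟩, Or.inl fun e he => ?_, fun e he => ?_⟩
          · rw [← hτ']; simp only [Formula.realize_inf, Formula.realize_not] at he; exact he.2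
          · simp only [Formula.realize_inf] at he; exact he.1
        · obtain ⟨e, he⟩ := σ.2
          have h1 : ∃ y, τ.Realize (Sum.elim (Sum.elim a e) (fun _ => y)) := by
            rw [← hτ']
            by_contra h2
            exact h ⟨e, by simp only [Formula.realize_inf, Formula.realize_not]; exact ⟨he, h2⟩⟩
          obtain ⟨y, hy⟩ := h1
          obtain ⟨s1, hs1⟩ := support_exists.{u, v, w} σ.1
          obtain ⟨s2, hs2⟩ := support_exists.{u, v, w} τ
          obtain ⟨k, hk⟩ := Infinite.exists_notMem_finset
            (s1.preimage Sum.inr (Sum.inr_injective.injOn) ∪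
              s2.preimage (fun n => Sum.inl (Sum.inr n)) (by intro x _ y _ h; simpa using h))
          simp only [Finset.mem_union, Finset.mem_preimage, not_or] at hk
          let ρ : L.Formula (κ ⊕ ℕ) := τ.relabel (Sum.elim id (fun _ => Sum.inr k))
          have hρ : ∀ e : ℕ → M, ρ.Realize (Sum.elim a e) ↔
              τ.Realize (Sum.elim (Sum.elim a e) (fun _ => e k)) := by
            intro e
            simp only [ρ, Formula.realize_relabel]
            apply iff_of_eq; congr 1; ext (i | i) <;> simp
          refine ⟨⟨σ.1 ⊓ ρ, Function.update e k y, ?_⟩, Or.inr ⟨k, fun e he => ?_⟩, fun e he => ?_⟩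
          · simp only [Formula.realize_inf]
            constructor
            · refine (hs1 M _ _ ?_).1 he
              rintro (i | i) hi
              · rfl
              · have : i ≠ k := by rintro rfl; exact hk.1 hi
                simp [this]
            · rw [hρ]
              refine (hs2 M _ _ ?_).1 hy
              rintro ((i | i) | i) hi
              · rfl
              · have : i ≠ k := by rintro rfl; exact hk.2 (Finset.mem_preimage.2 hi)
                exact (Function.update_of_ne this _ _).symm
              · exact (Function.update_self k y e).symm
          · simp only [Formula.realize_inf] at he
            exact (hρ e).1 he.2
          · simp only [Formula.realize_inf] at he; exact he.1 }
  let B : (Fin d → κ ⊕ ℕ) → Order.Cofinal (Cond (L := L) a) := fun t =>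
    { carrier := {σ | ∃ ψ ∈ q, ∀ e : ℕ → M, σ.1.Realize (Sum.elim a e) →
          ¬ ψ.Realize (Sum.elim a (Sum.elim a e ∘ t))}
      isCofinal := by
        intro σ
        obtain ⟨e, he⟩ := σ.2
        obtain ⟨s1, hs1⟩ := support_exists.{u, v, w} σ.1
        obtain ⟨K, hK⟩ : ∃ K : ℕ, (∀ i, Sum.inr i ∈ s1 → i < K) ∧
            ∀ j i, t j = Sum.inr i → i < K := by
          let S : Finset ℕ := (s1 ∪ Finset.univ.image t).preimage Sum.inr
            (Sum.inr_injective.injOn)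
          refine ⟨S.sup id + 1, fun i hi => ?_, fun j i hi => ?_⟩
          · have : i ∈ S := by simp [S, hi]
            have := Finset.le_sup (f := id) this
            simp only [id] at this; omega
          · have : i ∈ S := by simp [S, ← hi]
            have := Finset.le_sup (f := id) this
            simp only [id] at this; omega
        let g : ℕ → Fin (K + 1) := fun n => ⟨min n K, by omega⟩
        let G : κ ⊕ ℕ → κ ⊕ Fin (K + 1) := Sum.map id g
        let α' : L.Formula ((κ ⊕ Fin d) ⊕ Fin (K + 1)) :=
          (σ.1.relabel (Sum.map Sum.inl id ∘ G)) ⊓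
          Formula.iInf (fun j : Fin d => Term.equal (Term.var (Sum.inl (Sum.inr j)))
            (Term.var (Sum.map Sum.inl id (G (t j)))))
        let θ : L.Formula (κ ⊕ Fin d) := α'.iExs (Fin (K + 1))
        have hθ : ∀ x : Fin d → M, θ.Realize (Sum.elim a x) ↔ ∃ e' : Fin (K + 1) → M,
            σ.1.Realize (Sum.elim a (e' ∘ g)) ∧ x = Sum.elim a (e' ∘ g) ∘ t := by
          intro x
          have key : ∀ e' : Fin (K + 1) → M, Sum.elim (Sum.elim a x) e' ∘ (Sum.map Sum.inl id ∘ G) =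
              Sum.elim a (e' ∘ g) := by
            intro e'; ext (i | i) <;> simp [G]
          simp only [θ, α', Formula.realize_iExs, Formula.realize_inf, Formula.realize_relabel,
            Formula.realize_iInf, Formula.realize_equal, Term.realize_var]
          refine exists_congr fun e' => and_congr (by rw [key]) ?_
          rw [funext_iff]
          refine forall_congr' fun j => ?_
          simp only [Sum.elim_inl, Sum.elim_inr, Function.comp]
          rw [← congrFun (key e') (t j)]
          rfl
        have hagree : ∀ i, i < K → ((e ∘ Fin.val : Fin (K + 1) → M) ∘ g) i = e i := by
          intro i hi
          simp only [g, Function.comp]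
          congr 1; omega
        have hsat : ∃ x, θ.Realize (Sum.elim a x) := by
          refine ⟨Sum.elim a e ∘ t, (hθ _).2 ⟨e ∘ Fin.val, ?_, ?_⟩⟩
          · refine (hs1 M _ _ ?_).1 he
            rintro (i | i) hi
            · rfl
            · exact (hagree i (hK.1 i hi)).symm
          · ext j
            rcases htj : t j with i | i
            · simp [htj]
            · have := hagree i (hK.2 j i htj)
              simp only [Function.comp, htj, Sum.elim_inr] at this ⊢
              exact this.symm
        obtain ⟨ψ, hψ, x, h1, h2⟩ := hq θ hsat
        obtain ⟨e', h3, rfl⟩ := (hθ _).1 h1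
        let ρ : L.Formula (κ ⊕ ℕ) := ψ.relabel (Sum.elim Sum.inl t)
        have hρ : ∀ e : ℕ → M, ρ.Realize (Sum.elim a e) ↔
            ψ.Realize (Sum.elim a (Sum.elim a e ∘ t)) := by
          intro e
          simp only [ρ, Formula.realize_relabel]
          apply iff_of_eq; congr 1; ext (i | i) <;> simp
        refine ⟨⟨σ.1 ⊓ ρ.not, e' ∘ g, ?_⟩, ⟨ψ, hψ, fun e he => ?_⟩, fun e he => ?_⟩
        · simp only [Formula.realize_inf, Formula.realize_not]
          exact ⟨h3, fun h => h2 ((hρ _).1 h)⟩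
        · simp only [Formula.realize_inf, Formula.realize_not] at he
          exact fun h => he.2 ((hρ _).2 h)
        · simp only [Formula.realize_inf] at he; exact he.1 }
  have : Encodable (L.Formula ((κ ⊕ ℕ) ⊕ Unit) ⊕ (Fin d → κ ⊕ ℕ)) := Encodable.ofCountable _
  let p0 : Cond (L := L) a := ⟨⊤, fun _ => Classical.arbitrary M, by simp⟩
  let I := Order.idealOfCofinals p0 (Sum.elim A B)
  let Γ : Set (L.Formula (κ ⊕ ℕ)) := {ρ | ∃ σ ∈ I, ∀ e : ℕ → M, σ.1.Realize (Sum.elim a e) →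
    ρ.Realize (Sum.elim a e)}
  obtain ⟨N, _, _, x, hx⟩ := ext_lemma (M := M) Γ (by
    intro F hF
    have : ∃ σ ∈ I, ∀ ρ ∈ F, ∀ e : ℕ → M, σ.1.Realize (Sum.elim a e) →
        ρ.Realize (Sum.elim a e) := by
      induction F using Finset.induction_on with
      | empty => exact ⟨p0, Order.mem_idealOfCofinals _ _, by simp⟩
      | insert ρ F hρ ih =>
        obtain ⟨σ, hσ, h1⟩ := ih (fun z hz => hF (by simp [Finset.mem_coe.1 hz]))
        obtain ⟨σ', hσ', h2⟩ := hF (show ρ ∈ _ by simp)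
        obtain ⟨σ'', h3, h4, h5⟩ := I.directed σ hσ σ' hσ'
        refine ⟨σ'', h3, fun ρ' hρ' e he => ?_⟩
        rcases Finset.mem_insert.1 hρ' with rfl | h
        · exact h2 e (h5 e he)
        · exact h1 ρ' h e (h4 e he)
    obtain ⟨σ, -, h1⟩ := this
    obtain ⟨e, he⟩ := σ.2
    exact ⟨_, fun ρ hρ => h1 ρ hρ e he⟩)
  have htrue : ∀ σ : L.Formula κ, σ.Realize a → σ.Realize (x ∘ Sum.inl) := by
    intro σ hσ
    have := hx (σ.relabel Sum.inl) ⟨p0, Order.mem_idealOfCofinals _ _, fun e _ => by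
      rw [Formula.realize_relabel]; exact hσ⟩
    rwa [Formula.realize_relabel] at this
  refine ⟨N, inferInstance, inferInstance, x, fun σ => ⟨htrue σ, fun h => ?_⟩, fun τ => ?_,
    fun t => ?_⟩
  · by_contra h2
    exact (Formula.realize_not.1 (htrue σ.not (Formula.realize_not.2 h2))) h
  · rintro ⟨y, hy⟩
    obtain ⟨σ, h1, h2⟩ := Order.cofinal_meets_idealOfCofinals p0 (Sum.elim A B) (.inl τ)
    rcases h1 with h1 | ⟨k, h1⟩
    · exfalso
      have := hx (τ.iExs Unit).not ⟨σ, h2, fun e he => by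
        rw [Formula.realize_not, Formula.realize_iExs]
        rintro ⟨i, hi⟩
        exact h1 e he ⟨i (), hi⟩⟩
      rw [Formula.realize_not, Formula.realize_iExs] at this
      exact this ⟨fun _ => y, hy⟩
    · refine ⟨k, ?_⟩
      have := hx (τ.relabel (Sum.elim id (fun _ => Sum.inr k))) ⟨σ, h2, fun e he => by
        rw [Formula.realize_relabel]
        convert h1 e he using 1
        ext (i | i) <;> simp⟩
      rw [Formula.realize_relabel] at this
      convert this using 1
      ext (i | i) <;> simp
  · obtain ⟨σ, ⟨ψ, hψ, h1⟩, h2⟩ := Order.cofinal_meets_idealOfCofinals p0 (Sum.elim A B) (.inr t)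
    refine ⟨ψ, hψ, ?_⟩
    have := hx (ψ.relabel (Sum.elim Sum.inl t)).not ⟨σ, h2, fun e he => by
      rw [Formula.realize_not, Formula.realize_relabel]
      convert h1 e he using 2
      ext (i | i) <;> simp⟩
    rw [Formula.realize_not, Formula.realize_relabel] at this
    convert this using 2
    ext (i | i) <;> simp

theorem avoid_lemma (hL : L.card ≤ ℵ₀) [Infinite M] [Countable κ] {d : ℕ}
    (q : Set (L.Formula (κ ⊕ Fin d)))
    (hq : ∀ θ : L.Formula (κ ⊕ Fin d), (∃ x, θ.Realize (Sum.elim a x)) →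
      ∃ ψ ∈ q, ∃ x, θ.Realize (Sum.elim a x) ∧ ¬ ψ.Realize (Sum.elim a x)) :
    ∃ (_ : L.Structure ℕ) (a' : κ → ℕ),
      (∀ σ : L.Formula κ, σ.Realize a ↔ σ.Realize a') ∧
      (∀ x : Fin d → ℕ, ∃ ψ ∈ q, ¬ ψ.Realize (Sum.elim a' x)) := by
  classical
  obtain ⟨N, _, _, x, h1, h2, h3⟩ := avoid_pre a hL q hq
  have hκ : ∀ i : κ ⊕ ℕ, x i ∈ Set.range x := fun i => ⟨i, rfl⟩
  let S : L.Substructure N :=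
    { carrier := Set.range x
      fun_mem := by
        intro n f y hy
        choose i hi using hy
        let τ : L.Formula ((κ ⊕ ℕ) ⊕ Unit) := Term.equal (Term.var (.inr ()))
          (Term.func f (fun j => Term.var (.inl (i j))))
        obtain ⟨k, hk⟩ := h2 τ ⟨Structure.funMap f y, by
          simp only [τ, Formula.realize_equal, Term.realize_var, Term.realize_func, Sum.elim_inl,
            Sum.elim_inr]
          congr 1; ext j; rw [hi]⟩
        simp only [τ, Formula.realize_equal, Term.realize_var, Term.realize_func, Sum.elim_inl,
            Sum.elim_inr] at hk
        refine ⟨.inr k, hk.trans ?_⟩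
        congr 1; ext j; rw [hi] }
  have hS : S.IsElementary := by
    refine S.isElementary_of_exists ?_
    intro n φ y b hb
    have hy : ∀ j, ∃ i, x i = (y j : N) := fun j => (y j).2
    choose i hi using hy
    let τ : L.Formula ((κ ⊕ ℕ) ⊕ Unit) := (φ.toFormula).relabel
      (Sum.elim Empty.elim (Fin.snoc (fun j => Sum.inl (i j)) (Sum.inr ())))
    have hτ : ∀ z : N, τ.Realize (Sum.elim x (fun _ => z)) ↔
        φ.Realize default (Fin.snoc ((↑) ∘ y) z : _ → N) := by
      intro z
      simp only [τ, Formula.realize_relabel, BoundedFormula.realize_toFormula]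
      apply iff_of_eq; congr 1
      · ext j; exact j.elim
      · ext j
        refine Fin.lastCases ?_ (fun j => ?_) j <;> simp [hi]
    obtain ⟨k, hk⟩ := h2 τ ⟨b, (hτ b).2 hb⟩
    exact ⟨⟨x (.inr k), hκ _⟩, (hτ _).1 hk⟩
  let S' : L.ElementarySubstructure N := ⟨S, hS⟩
  have hel : L.ElementarilyEquivalent M N := by
    refine elementarilyEquivalent_iff.2 fun φ => ?_
    have := h1 (φ.relabel Empty.elim)
    rw [Formula.realize_relabel, Formula.realize_relabel] at this
    convert this using 1
    · unfold Sentence.Realize; congr!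
    · unfold Sentence.Realize; congr!
  have : Infinite N := hel.infinite_iff.1 inferInstance
  have : Infinite S' := S'.elementarilyEquivalent.infinite_iff.2 inferInstance
  have : Countable S' := by
    have : (Set.range x).Countable := Set.countable_range x
    exact this.to_subtype
  obtain ⟨e⟩ : Nonempty (S' ≃ ℕ) := by
    have := Classical.choice (nonempty_denumerable S')
    exact ⟨Denumerable.eqv S'⟩
  let : L.Structure ℕ := e.inducedStructure
  let E : S' ≃[L] ℕ := e.inducedStructureEquiv
  have hreal : ∀ {α : Type} (σ : L.Formula α) (y : α → S'),
      σ.Realize (fun i => e (y i)) ↔ σ.Realize (fun i => (y i : N)) := by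
    intro α σ y
    have e1 := StrongHomClass.realize_formula E σ (v := y)
    have e2 := S'.subtype.map_formula σ y
    exact e1.trans e2.symm
  refine ⟨inferInstance, fun i => e ⟨x (.inl i), hκ _⟩, fun σ => ?_, fun y => ?_⟩
  · rw [hreal, h1]; rfl
  · have hy : ∀ j, ∃ i, x i = (e.symm (y j) : N) := fun j => (e.symm (y j)).2
    choose t ht using hy
    obtain ⟨ψ, hψ, h4⟩ := h3 t
    refine ⟨ψ, hψ, fun h5 => h4 ?_⟩
    have := (hreal ψ (Sum.elim (fun i => ⟨x (.inl i), hκ _⟩) (fun j => e.symm (y j)))).1 (by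
      convert h5 using 1
      ext (i | i) <;> simp)
    convert this using 1
    ext (i | i) <;> simp [ht]

end avoid_sec
end PaperDef

namespace PaperDef

/-- formulas whose variables are `d`-tuples indexed by `X` -/
abbrev TF (L : FirstOrder.Language.{u, v}) (d : ℕ) (X : Type) := L.Formula (X × Fin d)

section TFsec

variable {L : FirstOrder.Language.{u, v}} {d : ℕ} {X Y : Type} {N : Type w} [L.Structure N]

/-- realization of tuple formulas -/
def RR (θ : TF L d X) (x : X → Fin d → N) : Prop := θ.Realize (fun p => x p.1 p.2)

/-- renaming -/
def ren (f : X → Y) (θ : TF L d X) : TF L d Y := Formula.relabel (Prod.map f id) θ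

theorem RR_ren (f : X → Y) (θ : TF L d X) (x : Y → Fin d → N) :
    RR (ren f θ) x ↔ RR θ (x ∘ f) := by
  unfold RR ren
  rw [Formula.realize_relabel]; rfl

/-- conjunction -/
def tand (θ η : TF L d X) : TF L d X := θ ⊓ η
/-- disjunction -/
def tor (θ η : TF L d X) : TF L d X := θ ⊔ η
/-- negation -/
def tnot (θ : TF L d X) : TF L d X := Formula.not θ

theorem RR_and (θ η : TF L d X) (x : X → Fin d → N) : RR (tand θ η) x ↔ RR θ x ∧ RR η x := by
  unfold RR tand; rw [Formula.realize_inf]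
theorem RR_or (θ η : TF L d X) (x : X → Fin d → N) : RR (tor θ η) x ↔ RR θ x ∨ RR η x := by
  unfold RR tor; rw [Formula.realize_sup]
theorem RR_not (θ : TF L d X) (x : X → Fin d → N) : RR (tnot θ) x ↔ ¬ RR θ x := by
  unfold RR tnot; rw [Formula.realize_not]

/-- existential quantification -/
noncomputable def tex (Y : Type) [Finite Y] (θ : TF L d (X ⊕ Y)) : TF L d X :=
  Formula.iExs (Y × Fin d) (Formula.relabel
    (fun p : (X ⊕ Y) × Fin d => (Sum.elim (fun x => Sum.inl (x, p.2)) (fun y => Sum.inr (y, p.2)) p.1 :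
      (X × Fin d) ⊕ (Y × Fin d))) θ)

theorem RR_ex [Finite Y] (θ : TF L d (X ⊕ Y)) (x : X → Fin d → N) :
    RR (tex Y θ) x ↔ ∃ t : Y → Fin d → N, RR θ (Sum.elim x t) := by
  unfold RR tex
  rw [Formula.realize_iExs]
  simp only [Formula.realize_relabel]
  constructor
  · rintro ⟨i, hi⟩
    refine ⟨fun y j => i (y, j), ?_⟩
    convert hi using 1
    ext ⟨(p | p), j⟩ <;> rfl
  · rintro ⟨t, ht⟩
    refine ⟨fun p => t p.1 p.2, ?_⟩
    convert ht using 1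
    ext ⟨(p | p), j⟩ <;> rfl

/-- finite conjunction -/
noncomputable def tinf {Y : Type} [Finite Y] (θ : Y → TF L d X) : TF L d X := Formula.iInf θ

theorem RR_inf [Finite Y] (θ : Y → TF L d X) (x : X → Fin d → N) :
    RR (tinf θ) x ↔ ∀ y, RR (θ y) x := by
  unfold RR tinf
  rw [Formula.realize_iInf]

/-- equality of tuples -/
noncomputable def teq (i j : X) : TF L d X :=
  Formula.iInf (fun k : Fin d => Term.equal (Term.var (i, k)) (Term.var (j, k)))

theorem RR_eq (i j : X) (x : X → Fin d → N) : RR (teq (L := L) i j) x ↔ x i = x j := by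
  unfold RR teq
  simp only [Formula.realize_iInf, Formula.realize_equal, Term.realize_var]
  exact funext_iff.symm

/-- truth of a unary formula -/
def R1 (θ : TF L d Unit) (x : Fin d → N) : Prop := RR θ (fun _ => x)
/-- truth of a binary formula -/
def R2 (θ : TF L d (Fin 2)) (x y : Fin d → N) : Prop := RR θ ![x, y]
/-- substitution -/
def ap1 (θ : TF L d Unit) (i : X) : TF L d X := ren (fun _ => i) θ
/-- substitution -/
def ap2 (θ : TF L d (Fin 2)) (i j : X) : TF L d X := ren ![i, j] θ

theorem RR_ap1 (θ : TF L d Unit) (i : X) (x : X → Fin d → N) :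
    RR (ap1 θ i) x ↔ R1 θ (x i) := by
  unfold ap1 R1; rw [RR_ren]; rfl
theorem RR_ap2 (θ : TF L d (Fin 2)) (i j : X) (x : X → Fin d → N) :
    RR (ap2 θ i j) x ↔ R2 θ (x i) (x j) := by
  unfold ap2 R2; rw [RR_ren]
  apply iff_of_eq; congr 1; ext k : 1; fin_cases k <;> rfl

theorem RR_support (θ : TF L d X) : ∃ s : Finset X, ∀ (N : Type w) [L.Structure N]
    (x y : X → Fin d → N), (∀ i ∈ s, x i = y i) → (RR θ x ↔ RR θ y) := by
  classical
  obtain ⟨s, hs⟩ := support_exists.{u, v, w} θ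
  refine ⟨s.image Prod.fst, fun N _ x y h => hs N _ _ ?_⟩
  intro p hp
  rw [h p.1 (Finset.mem_image_of_mem _ hp)]

theorem RR_equiv {N' : Type*} [L.Structure N'] (e : N ≃[L] N') (θ : TF L d X)
    (x : X → Fin d → N) : RR θ (fun i k => e (x i k)) ↔ RR θ x := by
  unfold RR
  exact StrongHomClass.realize_formula e θ (v := fun p => x p.1 p.2)

theorem R1_equiv {N' : Type*} [L.Structure N'] (e : N ≃[L] N') (θ : TF L d Unit)
    (x : Fin d → N) : R1 θ (fun k => e (x k)) ↔ R1 θ x :=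
  RR_equiv e θ (fun _ => x)

theorem R2_equiv {N' : Type*} [L.Structure N'] (e : N ≃[L] N') (θ : TF L d (Fin 2))
    (x y : Fin d → N) : R2 θ (fun k => e (x k)) (fun k => e (y k)) ↔ R2 θ x y := by
  unfold R2
  rw [← RR_equiv e θ (![x, y])]
  apply iff_of_eq; congr 1; ext k : 1; fin_cases k <;> rfl

/-- immediate successor -/
noncomputable def sucF (δ : TF L d Unit) (lt : TF L d (Fin 2)) : TF L d (Fin 2) :=
  tand (tand (ap1 δ 0) (ap1 δ 1)) (tand (ap2 lt 0 1)
    (tnot (tex Unit (tand (ap1 δ (Sum.inr ())) (tand (ap2 lt (Sum.inl 0) (Sum.inr ()))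
      (ap2 lt (Sum.inr ()) (Sum.inl 1)))))))

theorem R2_suc (δ : TF L d Unit) (lt : TF L d (Fin 2)) (x y : Fin d → N) :
    R2 (sucF δ lt) x y ↔ (R1 δ x ∧ R1 δ y) ∧ R2 lt x y ∧ ∀ z : Fin d → N, R1 δ z → R2 lt x z →
      R2 lt z y → False := by
  unfold R2 sucF
  simp only [RR_and, RR_not, RR_ex, RR_ap1, RR_ap2]
  refine and_congr Iff.rfl (and_congr ?_ ?_)
  · rfl
  · constructor
    · intro h z h1 h2 h3
      exact h ⟨fun _ => z, h1, h2, h3⟩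
    · rintro h ⟨t, h1, h2, h3⟩
      exact h _ h1 h2 h3

/-- `y` is at most the `k`-th successor of `x` -/
noncomputable def nearF (δ : TF L d Unit) (lt : TF L d (Fin 2)) : ℕ → TF L d (Fin 2)
  | 0 => tand (ap1 δ 0) (teq 0 1)
  | k + 1 => tor (nearF δ lt k) (tex Unit (tand (ap2 (nearF δ lt k) (Sum.inl 0) (Sum.inr ()))
      (ap2 (sucF δ lt) (Sum.inr ()) (Sum.inl 1))))

theorem R2_near_zero (δ : TF L d Unit) (lt : TF L d (Fin 2)) (x y : Fin d → N) :
    R2 (nearF δ lt 0) x y ↔ R1 δ x ∧ x = y := by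
  unfold R2 nearF
  simp only [RR_and, RR_ap1, RR_eq]
  rfl

theorem R2_near_succ (δ : TF L d Unit) (lt : TF L d (Fin 2)) (k : ℕ) (x y : Fin d → N) :
    R2 (nearF δ lt (k + 1)) x y ↔ R2 (nearF δ lt k) x y ∨ ∃ z, R2 (nearF δ lt k) x z ∧
      R2 (sucF δ lt) z y := by
  conv_lhs => unfold R2 nearF
  simp only [RR_or, RR_and, RR_ex, RR_ap2]
  refine or_congr Iff.rfl ?_
  constructor
  · rintro ⟨t, h1, h2⟩
    exact ⟨_, h1, h2⟩
  · rintro ⟨z, h1, h2⟩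
    exact ⟨fun _ => z, h1, h2⟩

/-- `x` is at most the `k`-th element -/
noncomputable def lowF (δ : TF L d Unit) (lt : TF L d (Fin 2)) : ℕ → TF L d Unit
  | 0 => tand (ap1 δ ()) (tnot (tex Unit (tand (ap1 δ (Sum.inr ())) (ap2 lt (Sum.inr ())
      (Sum.inl ())))))
  | k + 1 => tor (lowF δ lt k) (tex Unit (tand (ap1 (lowF δ lt k) (Sum.inr ()))
      (ap2 (sucF δ lt) (Sum.inr ()) (Sum.inl ()))))

theorem R1_low_zero (δ : TF L d Unit) (lt : TF L d (Fin 2)) (x : Fin d → N) :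
    R1 (lowF δ lt 0) x ↔ R1 δ x ∧ ∀ z, R1 δ z → R2 lt z x → False := by
  conv_lhs => unfold R1 lowF
  simp only [RR_and, RR_not, RR_ex, RR_ap1, RR_ap2]
  refine and_congr Iff.rfl ?_
  constructor
  · intro h z h1 h2
    exact h ⟨fun _ => z, h1, h2⟩
  · rintro h ⟨t, h1, h2⟩
    exact h _ h1 h2

theorem R1_low_succ (δ : TF L d Unit) (lt : TF L d (Fin 2)) (k : ℕ) (x : Fin d → N) :
    R1 (lowF δ lt (k + 1)) x ↔ R1 (lowF δ lt k) x ∨ ∃ z, R1 (lowF δ lt k) z ∧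
      R2 (sucF δ lt) z x := by
  conv_lhs => unfold R1 lowF
  simp only [RR_or, RR_and, RR_ex, RR_ap1, RR_ap2]
  refine or_congr Iff.rfl ?_
  constructor
  · rintro ⟨t, h1, h2⟩
    exact ⟨_, h1, h2⟩
  · rintro ⟨z, h1, h2⟩
    exact ⟨fun _ => z, h1, h2⟩

end TFsec

/-- linear order on a definable set -/
structure LinD {L : FirstOrder.Language.{u, v}} {d : ℕ} (δ : TF L d Unit) (lt : TF L d (Fin 2))
    (N : Type w) [L.Structure N] : Prop where
  irr : ∀ x : Fin d → N, R1 δ x → ¬ R2 lt x x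
  tr : ∀ x y z : Fin d → N, R1 δ x → R1 δ y → R1 δ z → R2 lt x y → R2 lt y z → R2 lt x z
  tot : ∀ x y : Fin d → N, R1 δ x → R1 δ y → x = y ∨ R2 lt x y ∨ R2 lt y x

/-- the data of Case 1 -/
structure Chain (L : FirstOrder.Language.{u, v}) (M : Type w) [L.Structure M] (d : ℕ) where
  δ : TF L d Unit
  lt : TF L d (Fin 2)
  lin : LinD δ lt M
  c : ℕ → Fin d → M
  cD : ∀ i, R1 δ (c i)
  cmono : ∀ i j, i < j → R2 lt (c i) (c j)
  cinit : ∀ x j, R1 δ x → R2 lt x (c j) → ∃ i, i < j ∧ x = c i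
  simple : ∀ θ : TF L d Unit, ∃ k, (∀ z, k ≤ z → R1 θ (c z)) ∨ (∀ z, k ≤ z → ¬ R1 θ (c z))

namespace Chain

variable {L : FirstOrder.Language.{u, v}} {M : Type w} [L.Structure M] {d : ℕ} (C : Chain L M d)

theorem lt_iff (i j : ℕ) : R2 C.lt (C.c i) (C.c j) ↔ i < j := by
  refine ⟨fun h => ?_, C.cmono i j⟩
  by_contra hn
  rcases (not_lt.1 hn).eq_or_lt with rfl | h2
  · exact C.lin.irr _ (C.cD _) h
  · exact C.lin.irr _ (C.cD _) (C.lin.tr _ _ _ (C.cD _) (C.cD _) (C.cD _) h (C.cmono _ _ h2))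

theorem inj {i j : ℕ} (h : C.c i = C.c j) : i = j := by
  rcases lt_trichotomy i j with h1 | h1 | h1
  · have := C.cmono _ _ h1; rw [h] at this; exact absurd this (C.lin.irr _ (C.cD _))
  · exact h1
  · have := C.cmono _ _ h1; rw [h] at this; exact absurd this (C.lin.irr _ (C.cD _))

theorem suc_iff (i : ℕ) (y : Fin d → M) : R2 (sucF C.δ C.lt) (C.c i) y ↔ y = C.c (i + 1) := by
  rw [R2_suc]
  constructor
  · rintro ⟨⟨-, h1⟩, h2, h3⟩
    rcases C.lin.tot y (C.c (i + 1)) h1 (C.cD _) with h | h | h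
    · exact h
    · obtain ⟨j, hj, rfl⟩ := C.cinit _ _ h1 h
      rw [C.lt_iff] at h2; omega
    · exact (h3 _ (C.cD _) (C.cmono _ _ (by omega)) h).elim
  · rintro rfl
    refine ⟨⟨C.cD _, C.cD _⟩, C.cmono _ _ (by omega), fun z h1 h2 h3 => ?_⟩
    obtain ⟨j, hj, rfl⟩ := C.cinit _ _ h1 h3
    rw [C.lt_iff] at h2; omega

theorem near_iff (k i : ℕ) (y : Fin d → M) : R2 (nearF C.δ C.lt k) (C.c i) y ↔
    ∃ j, y = C.c j ∧ i ≤ j ∧ j ≤ i + k := by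
  induction k generalizing y with
  | zero =>
    rw [R2_near_zero]
    constructor
    · rintro ⟨-, rfl⟩; exact ⟨i, rfl, le_rfl, le_rfl⟩
    · rintro ⟨j, rfl, h1, h2⟩
      obtain rfl : i = j := by omega
      exact ⟨C.cD _, rfl⟩
  | succ k ih =>
    rw [R2_near_succ, ih]
    simp only [ih]
    constructor
    · rintro (⟨j, rfl, h1, h2⟩ | ⟨z, ⟨j, rfl, h1, h2⟩, h3⟩)
      · exact ⟨j, rfl, h1, by omega⟩
      · exact ⟨j + 1, (C.suc_iff _ _).1 h3, by omega, by omega⟩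
    · rintro ⟨j, rfl, h1, h2⟩
      by_cases h : j ≤ i + k
      · exact Or.inl ⟨j, rfl, h1, h⟩
      · right
        refine ⟨C.c (j - 1), ⟨j - 1, rfl, by omega, by omega⟩, (C.suc_iff _ _).2 ?_⟩
        congr 1; omega

theorem low_iff (k : ℕ) (y : Fin d → M) : R1 (lowF C.δ C.lt k) y ↔ ∃ j, y = C.c j ∧ j ≤ k := by
  induction k generalizing y with
  | zero =>
    rw [R1_low_zero]
    constructor
    · rintro ⟨h1, h2⟩
      rcases C.lin.tot y (C.c 0) h1 (C.cD _) with h | h | h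
      · exact ⟨0, h, le_rfl⟩
      · obtain ⟨j, hj, -⟩ := C.cinit _ _ h1 h; omega
      · exact (h2 _ (C.cD _) h).elim
    · rintro ⟨j, rfl, h⟩
      refine ⟨C.cD _, fun z h1 h2 => ?_⟩
      obtain ⟨j, hj, -⟩ := C.cinit _ _ h1 h2; omega
  | succ k ih =>
    rw [R1_low_succ, ih]
    simp only [ih]
    constructor
    · rintro (⟨j, rfl, h1⟩ | ⟨z, ⟨j, rfl, h1⟩, h3⟩)
      · exact ⟨j, rfl, by omega⟩
      · exact ⟨j + 1, (C.suc_iff _ _).1 h3, by omega⟩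
    · rintro ⟨j, rfl, h1⟩
      by_cases h : j ≤ k
      · exact Or.inl ⟨j, rfl, h⟩
      · right
        refine ⟨C.c (j - 1), ⟨j - 1, rfl, by omega⟩, (C.suc_iff _ _).2 ?_⟩
        congr 1; omega

/-- the trace system of a chain -/
noncomputable def trSys : TrSys where
  Tr X R := ∃ θ : TF L d X, ∀ y : X → ℕ, R y ↔ RR θ (fun i => C.c (y i))
  and' := by
    rintro X R S ⟨θ, h⟩ ⟨η, h'⟩
    exact ⟨tand θ η, fun y => by rw [RR_and, ← h, ← h']⟩
  not' := by
    rintro X R ⟨θ, h⟩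
    exact ⟨tnot θ, fun y => by rw [RR_not, ← h]⟩
  lt' := ⟨C.lt, fun y => by
    dsimp only
    rw [← C.lt_iff]
    unfold R2
    apply iff_of_eq; congr 1; ext k : 1; fin_cases k <;> rfl⟩
  pre := by
    rintro X Y R f ⟨θ, h⟩
    exact ⟨ren f θ, fun y => by rw [RR_ren]; exact h _⟩
  bex := by
    rintro X Y _ R i ⟨θ, h⟩
    refine ⟨tex Y (tand θ (tinf fun j : Y => tand (ap1 C.δ (Sum.inr j))
      (tor (teq (Sum.inr j) (Sum.inl i)) (ap2 C.lt (Sum.inr j) (Sum.inl i))))), fun y => ?_⟩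
    simp only [RR_ex, RR_and, RR_inf, RR_or, RR_ap1, RR_ap2, RR_eq, Sum.elim_inl, Sum.elim_inr]
    constructor
    · rintro ⟨t, h1, h2⟩
      refine ⟨fun j => C.c (t j), ?_, fun j => ⟨C.cD _, ?_⟩⟩
      · rw [h] at h2
        convert h2 using 1
        ext (k | k) : 1 <;> rfl
      · rcases (h1 j).eq_or_lt with e | e
        · left; exact congrArg C.c e
        · right; exact C.cmono _ _ e
    · rintro ⟨t, h1, h2⟩
      have : ∀ j, ∃ n, n ≤ y i ∧ t j = C.c n := by
        intro j
        obtain ⟨h3, h4 | h4⟩ := h2 j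
        · exact ⟨_, le_rfl, h4⟩
        · obtain ⟨n, hn, e⟩ := C.cinit _ _ h3 h4
          exact ⟨n, hn.le, e⟩
      choose n hn e using this
      refine ⟨n, hn, (h _).2 ?_⟩
      convert h1 using 1
      ext (k | k) : 1
      · rfl
      · exact (e k).symm
  simple := by
    rintro R ⟨θ, h⟩
    obtain ⟨k, hk⟩ := C.simple θ
    refine ⟨k, hk.imp (fun h1 z hz => ?_) (fun h1 z hz => ?_)⟩
    · rw [h]; exact h1 z hz
    · rw [h]; exact h1 z hz

/-- eventually true formulas -/
def Ev {n : ℕ} (σ : TF L d (Fin n)) : Prop :=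
  ∃ k, ∀ y : Fin n → ℕ, TrSys.Sep k y → RR σ (fun i => C.c (y i))

theorem homog {n : ℕ} (σ : TF L d (Fin n)) : ∃ k,
    (∀ y : Fin n → ℕ, TrSys.Sep k y → RR σ (fun i => C.c (y i))) ∨
    (∀ y : Fin n → ℕ, TrSys.Sep k y → ¬ RR σ (fun i => C.c (y i))) :=
  TrSys.homog (T := C.trSys) n (fun y => RR σ (fun i => C.c (y i))) ⟨σ, fun _ => Iff.rfl⟩

/-- Ehrenfeucht-Mostowski families -/
def IsEM {N : Type*} [L.Structure N] {I : Type} [LinearOrder I] (a : I → Fin d → N) : Prop :=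
  ∀ (n : ℕ) (i : Fin n ↪o I) (σ : TF L d (Fin n)), C.Ev σ → RR σ (fun j => a (i j))

/-- eventually true unary formulas -/
def Ev1 (ψ : TF L d Unit) : Prop := ∃ k, ∀ z, k ≤ z → R1 ψ (C.c z)

/-- realizing the limit type -/
def PP {N : Type*} [L.Structure N] (x : Fin d → N) : Prop :=
  ∀ ψ : TF L d Unit, C.Ev1 ψ → R1 ψ x

/-- separation formula -/
noncomputable def sepF (k n : ℕ) {X : Type} (w : Fin n → X) : TF L d X :=
  tand (tinf fun t : Fin n => tand (ap1 C.δ (w t)) (tnot (ap1 (lowF C.δ C.lt k) (w t))))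
    (tinf fun p : {p : Fin n × Fin n // p.1 < p.2} => tand (ap2 C.lt (w p.1.1) (w p.1.2))
      (tnot (ap2 (nearF C.δ C.lt k) (w p.1.1) (w p.1.2))))

theorem RR_sepF {N : Type*} [L.Structure N] (k n : ℕ) {X : Type} (w : Fin n → X)
    (x : X → Fin d → N) : RR (C.sepF k n w) x ↔
      (∀ t, R1 C.δ (x (w t)) ∧ ¬ R1 (lowF C.δ C.lt k) (x (w t))) ∧
      ∀ s t, s < t → R2 C.lt (x (w s)) (x (w t)) ∧ ¬ R2 (nearF C.δ C.lt k) (x (w s)) (x (w t)) := by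
  unfold sepF
  simp only [RR_and, RR_inf, RR_not, RR_ap1, RR_ap2]
  refine and_congr Iff.rfl ⟨fun h s t hst => h ⟨(s, t), hst⟩, fun h p => h _ _ p.2⟩

theorem psi {n k : ℕ} (σ : TF L d (Fin (n + 1)))
    (hσ : ∀ y : Fin (n + 1) → ℕ, TrSys.Sep k y → RR σ (fun i => C.c (y i)))
    {N : Type*} [L.Structure N] (x : Fin (n + 1) → Fin d → N)
    (h1 : ∀ t, R1 C.δ (x t) ∧ ¬ R1 (lowF C.δ C.lt k) (x t))
    (h2 : ∀ s t, s < t → R2 C.lt (x s) (x t) ∧ ¬ R2 (nearF C.δ C.lt k) (x s) (x t))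
    (h3 : C.PP (x (Fin.last n))) : RR σ x := by
  let Ψ : TF L d Unit := tnot (tex (Fin (n + 1)) (tand (tand (teq (Sum.inl ()) (Sum.inr (Fin.last n)))
    (C.sepF k (n + 1) (fun t => Sum.inr t))) (tnot (ren Sum.inr σ))))
  have hΨ : ∀ (N : Type _) [L.Structure N] (z : Fin d → N), R1 Ψ z ↔ ¬ ∃ t : Fin (n + 1) → Fin d → N,
      (z = t (Fin.last n) ∧ (∀ s, R1 C.δ (t s) ∧ ¬ R1 (lowF C.δ C.lt k) (t s)) ∧
      ∀ s s', s < s' → R2 C.lt (t s) (t s') ∧ ¬ R2 (nearF C.δ C.lt k) (t s) (t s')) ∧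
      ¬ RR σ t := by
    intro N _ z
    unfold R1
    simp only [Ψ, RR_not, RR_ex, RR_and, RR_eq, RR_ren, RR_sepF, Sum.elim_inl, Sum.elim_inr]
    rfl
  have hΨ' : ∀ (z : Fin d → M), R1 Ψ z ↔ ¬ ∃ t : Fin (n + 1) → Fin d → M,
      (z = t (Fin.last n) ∧ (∀ s, R1 C.δ (t s) ∧ ¬ R1 (lowF C.δ C.lt k) (t s)) ∧
      ∀ s s', s < s' → R2 C.lt (t s) (t s') ∧ ¬ R2 (nearF C.δ C.lt k) (t s) (t s')) ∧
      ¬ RR σ t := by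
    intro z
    unfold R1
    simp only [Ψ, RR_not, RR_ex, RR_and, RR_eq, RR_ren, RR_sepF, Sum.elim_inl, Sum.elim_inr]
    rfl
  have hev : C.Ev1 Ψ := by
    refine ⟨0, fun z _ => ?_⟩
    rw [hΨ']
    rintro ⟨t, ⟨e, h4, h5⟩, h6⟩
    have : ∀ s, ∃ i, t s = C.c i := by
      intro s
      rcases (Fin.le_last s).eq_or_lt with rfl | h
      · exact ⟨z, e.symm⟩
      · have := (h5 _ _ h).1
        rw [← e] at this
        obtain ⟨i, -, hi⟩ := C.cinit _ _ (h4 s).1 this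
        exact ⟨i, hi⟩
    choose y hy using this
    obtain rfl : t = fun s => C.c (y s) := funext hy
    refine h6 (hσ y ⟨fun s => ?_, fun s s' hs => ?_⟩)
    · have := (h4 s).2
      rw [C.low_iff] at this
      by_contra hn
      exact this ⟨y s, rfl, by omega⟩
    · have h7 := h5 s s' hs
      rw [C.near_iff, C.lt_iff] at h7
      by_contra hn
      exact h7.2 ⟨y s', rfl, h7.1.le, by omega⟩
  have := (hΨ N _).1 (h3 Ψ hev)
  by_contra hn
  exact this ⟨x, ⟨rfl, h1, h2⟩, hn⟩

theorem ev1_D : C.Ev1 C.δ := ⟨0, fun z _ => C.cD z⟩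

theorem ev1_low (k : ℕ) : C.Ev1 (tnot (lowF C.δ C.lt k)) := by
  refine ⟨k + 1, fun z hz => ?_⟩
  unfold R1
  rw [RR_not]
  intro h
  obtain ⟨j, e, hj⟩ := (C.low_iff k _).1 h
  have := C.inj e
  omega

section EM

variable {N : Type*} [L.Structure N] {I : Type} [LinearOrder I] {a : I → Fin d → N}

theorem IsEM.PP (h : C.IsEM a) (i : I) : C.PP (a i) := by
  rintro ψ ⟨k, hk⟩
  let f : Fin 1 ↪o I := OrderEmbedding.ofStrictMono (fun _ => i)
    (fun s t hst => absurd hst (by simp [Subsingleton.elim s t]))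
  have := h 1 f (ap1 ψ 0) ⟨k, fun y hy => by
    rw [RR_ap1]; exact hk _ (hy.1 0).le⟩
  rw [RR_ap1] at this
  exact this

theorem IsEM.pair (h : C.IsEM a) {i j : I} (hij : i < j) (σ : TF L d (Fin 2)) (k : ℕ)
    (hσ : ∀ s t, s + k < t → R2 σ (C.c s) (C.c t)) : R2 σ (a i) (a j) := by
  let f : Fin 2 ↪o I := OrderEmbedding.ofStrictMono ![i, j] (by
    intro s t hst
    fin_cases s <;> fin_cases t <;> simp_all)
  have := h 2 f (ap2 σ 0 1) ⟨k, fun y hy => by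
    rw [RR_ap2]; exact hσ _ _ (hy.2 0 1 (by simp))⟩
  rw [RR_ap2] at this
  exact this

theorem IsEM.lt (h : C.IsEM a) {i j : I} (hij : i < j) : R2 C.lt (a i) (a j) :=
  h.pair C hij _ 0 (fun s t hst => C.cmono _ _ (by omega))

theorem IsEM.not_near (h : C.IsEM a) {i j : I} (hij : i < j) (k : ℕ) :
    ¬ R2 (nearF C.δ C.lt k) (a i) (a j) := by
  have := h.pair C hij (tnot (nearF C.δ C.lt k)) k (fun s t hst => by
    unfold R2
    rw [RR_not]
    intro h
    obtain ⟨j, e, h1, h2⟩ := (C.near_iff k _ _).1 h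
    have := C.inj e
    omega)
  unfold R2 at this
  rwa [RR_not] at this

theorem IsEM.transfer (h : C.IsEM a) {X : Type} [Finite X] (θ : TF L d X)
    (hθ : ∀ x : X → Fin d → M, RR θ x) (x : X → Fin d → N) : RR θ x := by
  let θ' : TF L d (Fin 0) := tnot (tex X (tnot (ren Sum.inr θ)))
  let f : Fin 0 ↪o I := OrderEmbedding.ofStrictMono Fin.elim0 (fun s => s.elim0)
  have := h 0 f θ' ⟨0, fun y _ => by
    simp only [θ', RR_not, RR_ex, RR_ren, not_exists, not_not]
    exact fun t => hθ _⟩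
  simp only [θ', RR_not, RR_ex, RR_ren, not_exists, not_not] at this
  exact this x

theorem IsEM.lin (h : C.IsEM a) : LinD C.δ C.lt N where
  irr x hx hl := by
    have := h.transfer C (X := Unit) (tnot (tand (ap1 C.δ ()) (ap2 C.lt () ()))) (by
      intro x
      simp only [RR_not, RR_and, RR_ap1, RR_ap2, not_and]
      exact C.lin.irr _) (fun _ => x)
    simp only [RR_not, RR_and, RR_ap1, RR_ap2, not_and] at this
    exact this hx hl
  tr x y z hx hy hz h1 h2 := by
    have := h.transfer C (X := Fin 3) (tnot (tand (ap1 C.δ 0) (tand (ap1 C.δ 1) (tand (ap1 C.δ 2)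
      (tand (ap2 C.lt 0 1) (tand (ap2 C.lt 1 2) (tnot (ap2 C.lt 0 2)))))))) (by
      intro x
      simp only [RR_not, RR_and, RR_ap1, RR_ap2, not_and, not_not]
      exact C.lin.tr _ _ _) ![x, y, z]
    simp only [RR_not, RR_and, RR_ap1, RR_ap2, not_and, not_not] at this
    exact this hx hy hz h1 h2
  tot x y hx hy := by
    have := h.transfer C (X := Fin 2) (tor (tnot (tand (ap1 C.δ 0) (ap1 C.δ 1)))
      (tor (teq 0 1) (tor (ap2 C.lt 0 1) (ap2 C.lt 1 0)))) (by
      intro x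
      simp only [RR_not, RR_and, RR_or, RR_eq, RR_ap1, RR_ap2]
      by_cases h : R1 C.δ (x 0) ∧ R1 C.δ (x 1)
      · exact Or.inr (C.lin.tot _ _ h.1 h.2)
      · exact Or.inl h) ![x, y]
    simp only [RR_not, RR_and, RR_or, RR_eq, RR_ap1, RR_ap2] at this
    exact this.resolve_left (fun h => h ⟨hx, hy⟩)

end EM

end Chain
end PaperDef

namespace PaperDef

section TF_avoid
variable {L : FirstOrder.Language.{u, v}} {M : Type w} [L.Structure M] {d : ℕ} {X : Type}

theorem ext_TF [Nonempty M] (Γ : Set (TF L d X))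
    (h : ∀ F : Finset (TF L d X), (F : Set (TF L d X)) ⊆ Γ →
      ∃ x : X → Fin d → M, ∀ φ ∈ F, RR φ x) :
    ∃ (N : Type (max u v)) (_ : L.Structure N) (_ : Nonempty N) (x : X → Fin d → N),
      ∀ φ ∈ Γ, RR φ x := by
  obtain ⟨N, i1, i2, x, hx⟩ := ext_lemma (M := M) Γ (fun F hF => by
    obtain ⟨x, hx⟩ := h F hF
    exact ⟨fun p => x p.1 p.2, hx⟩)
  exact ⟨N, i1, i2, fun i k => x (i, k), hx⟩

theorem avoid_TF (hL : L.card ≤ ℵ₀) [Infinite M] [Countable X] (a : X → Fin d → M)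
    (q : Set (TF L d (X ⊕ Unit)))
    (hq : ∀ θ : TF L d (X ⊕ Unit), (∃ x, RR θ (Sum.elim a (fun _ => x))) →
      ∃ ψ ∈ q, ∃ x, RR θ (Sum.elim a (fun _ => x)) ∧ ¬ RR ψ (Sum.elim a (fun _ => x))) :
    ∃ (_ : L.Structure ℕ) (a' : X → Fin d → ℕ),
      (∀ σ : TF L d X, RR σ a ↔ RR σ a') ∧
      (∀ x : Fin d → ℕ, ∃ ψ ∈ q, ¬ RR ψ (Sum.elim a' (fun _ => x))) := by
  let g : (X ⊕ Unit) × Fin d → (X × Fin d) ⊕ Fin d :=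
    fun p => Sum.elim (fun i => Sum.inl (i, p.2)) (fun _ => Sum.inr p.2) p.1
  let g' : (X × Fin d) ⊕ Fin d → (X ⊕ Unit) × Fin d :=
    Sum.elim (fun p => (Sum.inl p.1, p.2)) (fun k => (Sum.inr (), k))
  have hg : ∀ {N : Type w} [L.Structure N] (a : X → Fin d → N) (x : Fin d → N)
      (ψ : TF L d (X ⊕ Unit)), (Formula.relabel g ψ).Realize (Sum.elim (fun p => a p.1 p.2) x) ↔
      RR ψ (Sum.elim a (fun _ => x)) := by
    intro N _ a x ψ
    rw [Formula.realize_relabel]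
    unfold RR
    apply iff_of_eq; congr 1; ext ⟨(i | i), k⟩ <;> rfl
  have hg0 : ∀ [L.Structure ℕ] (a : X → Fin d → ℕ) (x : Fin d → ℕ)
      (ψ : TF L d (X ⊕ Unit)), (Formula.relabel g ψ).Realize (Sum.elim (fun p => a p.1 p.2) x) ↔
      RR ψ (Sum.elim a (fun _ => x)) := by
    intro _ a x ψ
    rw [Formula.realize_relabel]
    unfold RR
    apply iff_of_eq; congr 1; ext ⟨(i | i), k⟩ <;> rfl
  have hg' : ∀ (x : Fin d → M) (θ : L.Formula ((X × Fin d) ⊕ Fin d)),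
      θ.Realize (Sum.elim (fun p => a p.1 p.2) x) ↔
      RR (Formula.relabel g' θ : TF L d (X ⊕ Unit)) (Sum.elim a (fun _ => x)) := by
    intro x θ
    unfold RR
    rw [Formula.realize_relabel]
    apply iff_of_eq; congr 1; ext (i | i) <;> rfl
  obtain ⟨i0, a', h1, h2⟩ := avoid_lemma (L := L) (fun p : X × Fin d => a p.1 p.2) hL
    ((fun ψ : TF L d (X ⊕ Unit) => Formula.relabel g ψ) '' q) (by
      rintro θ ⟨x, hx⟩
      obtain ⟨ψ, hψ, x', h1, h2⟩ := hq (Formula.relabel g' θ) ⟨x, (hg' _ _).1 hx⟩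
      exact ⟨_, ⟨ψ, hψ, rfl⟩, x', (hg' _ _).2 h1, fun h => h2 ((hg _ _ _).1 h)⟩)
  refine ⟨i0, fun i k => a' (i, k), fun σ => h1 σ, fun x => ?_⟩
  obtain ⟨_, ⟨ψ, hψ, rfl⟩, h3⟩ := h2 x
  exact ⟨ψ, hψ, fun h => h3 ((hg0 _ _ _).2 h)⟩

end TF_avoid

namespace Chain

variable {L : FirstOrder.Language.{u, v}} {M : Type w} [L.Structure M] {d : ℕ} (C : Chain L M d)

theorem exists_EM (I : Type) [LinearOrder I] [Nonempty M] :
    ∃ (N : Type (max u v)) (_ : L.Structure N) (_ : Nonempty N) (a : I → Fin d → N), C.IsEM a := by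
  classical
  let Γ : Set (TF L d I) := {φ | ∃ (n : ℕ) (i : Fin n ↪o I) (σ : TF L d (Fin n)), C.Ev σ ∧
    φ = ren i σ}
  obtain ⟨N, i1, i2, a, ha⟩ := ext_TF (M := M) Γ (by
    intro F hF
    have key : ∃ (k : ℕ) (S : Finset I), ∀ y : I → ℕ, (∀ i ∈ S, k < y i) →
        (∀ i ∈ S, ∀ j ∈ S, i < j → y i + k < y j) → ∀ φ ∈ F, RR φ (fun i => C.c (y i)) := by
      induction F using Finset.induction_on with
      | empty => exact ⟨0, ∅, by simp⟩
      | insert φ F hφ ih =>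
        obtain ⟨k, S, h⟩ := ih (fun z hz => hF (by simp [Finset.mem_coe.1 hz]))
        obtain ⟨n, i, σ, ⟨k', hk'⟩, rfl⟩ := hF (show φ ∈ _ by simp)
        refine ⟨k + k', S ∪ Finset.univ.image i, fun y h1 h2 φ hφ => ?_⟩
        rcases Finset.mem_insert.1 hφ with rfl | hφ
        · rw [RR_ren]
          refine hk' (fun j => y (i j)) ⟨fun s => ?_, fun s t hst => ?_⟩
          · have := h1 (i s) (by simp)
            dsimp only
            omega
          · have := h2 (i s) (by simp) (i t) (by simp) (by simpa using hst)
            dsimp only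
            omega
        · refine h y (fun i hi => ?_) (fun i hi j hj hij => ?_) φ hφ
          · have := h1 i (by simp [hi]); omega
          · have := h2 i (by simp [hi]) j (by simp [hj]) hij; omega
    obtain ⟨k, S, h⟩ := key
    refine ⟨_, h (fun i => (k + 1) * ((S.filter (· < i)).card + 1)) (fun i hi => ?_)
      (fun i hi j hj hij => ?_)⟩
    · nlinarith
    · have hlt : (S.filter (· < i)).card < (S.filter (· < j)).card := by
        apply Finset.card_lt_card
        rw [Finset.ssubset_iff_of_subset]
        · exact ⟨i, by simp [hi, hij], by simp⟩
        · intro z hz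
          simp only [Finset.mem_filter] at hz ⊢
          exact ⟨hz.1, hz.2.trans hij⟩
      have := Nat.mul_le_mul_left (k + 1) hlt
      simp only [Nat.succ_eq_add_one] at this
      nlinarith)
  refine ⟨N, i1, i2, a, fun n i σ hσ => ?_⟩
  have := ha (ren i σ) ⟨n, i, σ, hσ, rfl⟩
  rw [RR_ren] at this
  exact this

theorem cut_exists {n : ℕ} (p : Fin n → Prop) (hp : ∀ s t, s < t → p t → p s) :
    ∃ j : Fin (n + 1), ∀ s : Fin n, p s ↔ s.castSucc < j := by
  classical
  let A : Set ℕ := {m | ∀ s : Fin n, p s → s.1 < m}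
  have hA : n ∈ A := fun s _ => s.2
  refine ⟨⟨sInf A, by have := Nat.sInf_le hA; omega⟩, fun s => ?_⟩
  have h1 : sInf A ∈ A := Nat.sInf_mem ⟨n, hA⟩
  constructor
  · intro h
    exact h1 s h
  · intro h
    have h : s.1 < sInf A := h
    by_contra hn
    have : s.1 ∈ A := by
      intro t ht
      by_contra h2
      have h3 : s ≤ t := by
        have := not_lt.1 h2
        exact this
      rcases h3.eq_or_lt with rfl | h4
      · exact hn ht
      · exact hn (hp _ _ h4 ht)
    have := Nat.sInf_le this
    omega

/-- the type to be omitted -/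
def qq (I : Type) : Set (TF L d (I ⊕ Unit)) :=
  {φ | (∃ ψ, C.Ev1 ψ ∧ φ = ap1 ψ (Sum.inr ())) ∨
    (∃ k i, φ = tnot (ap2 (nearF C.δ C.lt k) (Sum.inl i) (Sum.inr ()))) ∨
    (∃ k i, φ = tnot (ap2 (nearF C.δ C.lt k) (Sum.inr ()) (Sum.inl i)))}

theorem nonisol_fin {n : ℕ} {N : Type*} [L.Structure N] {I : Type} [LinearOrder I]
    {a : I → Fin d → N} (hEM : C.IsEM a) (f : Fin n ↪o I) (θ : TF L d (Fin n ⊕ Unit))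
    (b : Fin d → N) (hb : RR θ (Sum.elim (fun s => a (f s)) (fun _ => b)))
    (hP : C.PP b) (h1 : ∀ k i, ¬ R2 (nearF C.δ C.lt k) (a i) b)
    (h2 : ∀ k i, ¬ R2 (nearF C.δ C.lt k) b (a i)) :
    ∃ b', RR θ (Sum.elim (fun s => a (f s)) (fun _ => b')) ∧
      ((∃ k, R1 (lowF C.δ C.lt k) b') ∨ (∃ k s, R2 (nearF C.δ C.lt k) (a (f s)) b')) := by
  have lin := hEM.lin C
  have hD : R1 C.δ b := hP _ C.ev1_D
  have haD : ∀ i, R1 C.δ (a i) := fun i => hEM.PP C i _ C.ev1_D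
  have hne : ∀ i, a i ≠ b := fun i e => h1 0 i ((R2_near_zero _ _ _ _).2 ⟨haD i, e⟩)
  obtain ⟨j, hj⟩ := cut_exists (fun s : Fin n => R2 C.lt (a (f s)) b) (by
    intro s t hst h
    exact lin.tr _ _ _ (haD _) (haD _) hD (hEM.lt C (by simpa using hst)) h)
  have hj' : ∀ s : Fin n, j ≤ s.castSucc → R2 C.lt b (a (f s)) := by
    intro s hs
    rcases lin.tot _ _ (haD (f s)) hD with h | h | h
    · exact absurd h (hne _)
    · exact absurd ((hj s).1 h) (not_lt.2 hs)
    · exact h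
  let θ' : TF L d (Fin (n + 1)) := ren (Sum.elim j.succAbove (fun _ => j)) θ
  have hθ' : ∀ {K : Type w} [L.Structure K] (x : Fin n → Fin d → K) (z : Fin d → K),
      RR θ' (j.insertNth z x : Fin (n + 1) → Fin d → K) ↔ RR θ (Sum.elim x (fun _ => z)) := by
    intro K _ x z
    simp only [θ', RR_ren]
    apply iff_of_eq; congr 1; ext (s | s) : 1 <;> simp
  have hθ'' : ∀ (x : Fin n → Fin d → N) (z : Fin d → N),
      RR θ' (j.insertNth z x : Fin (n + 1) → Fin d → N) ↔ RR θ (Sum.elim x (fun _ => z)) := by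
    intro x z
    simp only [θ', RR_ren]
    apply iff_of_eq; congr 1; ext (s | s) : 1 <;> simp
  obtain ⟨k, hk | hk⟩ := C.homog θ'
  swap
  · exfalso
    have := C.psi (tnot θ') (k := k) (fun y hy => (RR_not _ _).2 (hk y hy))
      (j.insertNth b (fun s => a (f s)) : Fin (n + 1) → Fin d → N) (by
        intro t
        have : C.PP ((j.insertNth b (fun s => a (f s)) : Fin (n + 1) → Fin d → N) t) := by
          rcases Fin.eq_self_or_eq_succAbove j t with rfl | ⟨s, rfl⟩
          · simpa using hP
          · simpa using hEM.PP C (f s)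
        have h3 := this _ (C.ev1_low k)
        unfold R1 at h3
        rw [RR_not] at h3
        exact ⟨this _ C.ev1_D, h3⟩) (by
        intro s t hst
        rcases Fin.eq_self_or_eq_succAbove j s with hs | ⟨s, hs⟩ <;>
        rcases Fin.eq_self_or_eq_succAbove j t with ht | ⟨t, ht⟩ <;>
        rw [hs, ht] at hst ⊢
        · exact absurd hst (lt_irrefl _)
        · simp only [Fin.insertNth_apply_same, Fin.insertNth_apply_succAbove]
          exact ⟨hj' _ (Fin.lt_succAbove_iff_le_castSucc _ _ |>.1 hst), h2 _ _⟩
        · simp only [Fin.insertNth_apply_same, Fin.insertNth_apply_succAbove]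
          exact ⟨(hj _).2 (Fin.succAbove_lt_iff_castSucc_lt _ _ |>.1 hst), h1 _ _⟩
        · simp only [Fin.insertNth_apply_succAbove]
          have : f s < f t := by simpa using hst
          exact ⟨hEM.lt C this, hEM.not_near C this k⟩) (by
          rcases Fin.eq_self_or_eq_succAbove j (Fin.last n) with h | ⟨s, h⟩
          · rw [h]; simpa using hP
          · rw [h]; simpa using hEM.PP C (f s))
    rw [RR_not, hθ''] at this
    exact this hb
  · have hins : ∀ (y : Fin n → ℕ) (z : ℕ), TrSys.Sep k y → k < z →
        (∀ s : Fin n, s.castSucc < j → y s + k < z) → (∀ s : Fin n, j ≤ s.castSucc → z + k < y s) →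
        RR θ (Sum.elim (fun s => C.c (y s)) (fun _ => C.c z)) := by
      intro y z hy hz h3 h4
      rw [← hθ']
      have := hk (j.insertNth z y : Fin (n + 1) → ℕ) ⟨fun t => ?_, fun s t hst => ?_⟩
      · convert this using 1
        ext t : 1
        rcases Fin.eq_self_or_eq_succAbove j t with rfl | ⟨t, rfl⟩ <;> simp
      · rcases Fin.eq_self_or_eq_succAbove j t with rfl | ⟨t, rfl⟩
        · simpa using hz
        · simpa using hy.1 t
      · rcases Fin.eq_self_or_eq_succAbove j s with hs | ⟨s, hs⟩ <;>
        rcases Fin.eq_self_or_eq_succAbove j t with ht | ⟨t, ht⟩ <;>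
        rw [hs, ht] at hst ⊢
        · exact absurd hst (lt_irrefl _)
        · simp only [Fin.insertNth_apply_same, Fin.insertNth_apply_succAbove]
          exact h4 _ (Fin.lt_succAbove_iff_le_castSucc _ _ |>.1 hst)
        · simp only [Fin.insertNth_apply_same, Fin.insertNth_apply_succAbove]
          exact h3 _ (Fin.succAbove_lt_iff_castSucc_lt _ _ |>.1 hst)
        · simp only [Fin.insertNth_apply_succAbove]
          exact hy.2 s t (by simpa using hst)
    by_cases hj0 : j = 0
    · have := hEM n f (tex Unit (tand θ (ap1 (lowF C.δ C.lt (k + 1)) (Sum.inr ())))) ⟨2 * k + 2, by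
        intro y hy
        rw [RR_ex]
        refine ⟨fun _ => C.c (k + 1), ?_⟩
        rw [RR_and, RR_ap1]
        refine ⟨hins y (k + 1) ⟨fun s => ?_, fun s t hst => ?_⟩ (by omega) ?_ ?_,
          (C.low_iff _ _).2 ⟨k + 1, rfl, le_rfl⟩⟩
        · have := hy.1 s; omega
        · have := hy.2 s t hst; omega
        · intro s hs
          rw [hj0] at hs
          exact absurd hs (by simp)
        · intro s _
          have := hy.1 s; omega⟩
      rw [RR_ex] at this
      obtain ⟨t, ht⟩ := this
      rw [RR_and, RR_ap1] at ht
      exact ⟨t (), ht.1, Or.inl ⟨_, ht.2⟩⟩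
    · obtain ⟨i, rfl⟩ := Fin.exists_succ_eq.2 hj0
      have := hEM n f (tex Unit (tand θ (ap2 (nearF C.δ C.lt (k + 1)) (Sum.inl i) (Sum.inr ()))))
        ⟨2 * k + 2, by
        intro y hy
        rw [RR_ex]
        refine ⟨fun _ => C.c (y i + (k + 1)), ?_⟩
        rw [RR_and, RR_ap2]
        refine ⟨hins y (y i + (k + 1)) ⟨fun s => ?_, fun s t hst => ?_⟩ (by omega) ?_ ?_,
          (C.near_iff _ _ _).2 ⟨y i + (k + 1), rfl, by omega, le_rfl⟩⟩
        · have := hy.1 s; omega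
        · have := hy.2 s t hst; omega
        · intro s hs
          have hs : s ≤ i := Fin.castSucc_lt_succ_iff.1 hs
          rcases hs.eq_or_lt with rfl | h
          · omega
          · have := hy.2 s i h; omega
        · intro s hs
          have hs : i < s := Fin.succ_le_castSucc_iff.1 hs
          have := hy.2 i s hs; omega⟩
      rw [RR_ex] at this
      obtain ⟨t, ht⟩ := this
      rw [RR_and, RR_ap2] at ht
      exact ⟨t (), ht.1, Or.inr ⟨_, i, ht.2⟩⟩

end Chain
end PaperDef

namespace PaperDef

section sens
variable {L : FirstOrder.Language.{u, v}} {N : Type w} [L.Structure N] {d : ℕ} {X : Type}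

/-- sentences as tuple formulas -/
def sen (σ : L.Sentence) : TF L d X := Formula.relabel Empty.elim σ

theorem RR_sen (σ : L.Sentence) (x : X → Fin d → N) : RR (sen σ) x ↔ N ⊨ σ := by
  unfold RR sen Sentence.Realize
  rw [Formula.realize_relabel]
  apply iff_of_eq; congr 1
  exact Subsingleton.elim _ _

theorem infinite_of_sen {N' : Type*} [L.Structure N'] [Infinite N]
    (h : ∀ σ : L.Sentence, N ⊨ σ → N' ⊨ σ) : Infinite N' := by
  have : L.ElementarilyEquivalent N N' := by
    rw [elementarilyEquivalent_iff]
    intro σ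
    refine ⟨h σ, fun h2 => ?_⟩
    by_contra hn
    have := h σ.not ((Sentence.realize_not _).2 hn)
    exact (Sentence.realize_not _).1 this h2
  exact (ElementarilyEquivalent.infinite_iff this).1 inferInstance

end sens

namespace Chain

variable {L : FirstOrder.Language.{u, v}} {M : Type w} [L.Structure M] {d : ℕ} (C : Chain L M d)

theorem IsEM.sen {N : Type*} [L.Structure N] {I : Type} [LinearOrder I] {a : I → Fin d → N}
    (h : C.IsEM a) (σ : L.Sentence) (hσ : M ⊨ σ) : N ⊨ σ := by
  let f : Fin 0 ↪o I := OrderEmbedding.ofStrictMono Fin.elim0 (fun s => s.elim0)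
  have := h 0 f (PaperDef.sen σ) ⟨0, fun y _ => (RR_sen _ _).2 hσ⟩
  exact (RR_sen _ _).1 this

theorem nonisol {N : Type*} [L.Structure N] {I : Type} [LinearOrder I]
    {a : I → Fin d → N} (hEM : C.IsEM a) (θ : TF L d (I ⊕ Unit))
    (b : Fin d → N) (hb : RR θ (Sum.elim a (fun _ => b))) :
    ∃ ψ ∈ C.qq I, ∃ x, RR θ (Sum.elim a (fun _ => x)) ∧ ¬ RR ψ (Sum.elim a (fun _ => x)) := by
  classical
  by_cases hall : ∃ ψ ∈ C.qq I, ¬ RR ψ (Sum.elim a (fun _ => b))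
  · obtain ⟨ψ, h1, h2⟩ := hall
    exact ⟨ψ, h1, b, hb, h2⟩
  push Not at hall
  have hP : C.PP b := fun ψ hψ => by
    have := hall _ (Or.inl ⟨ψ, hψ, rfl⟩)
    rw [RR_ap1] at this
    exact this
  have h1 : ∀ k i, ¬ R2 (nearF C.δ C.lt k) (a i) b := fun k i => by
    have := hall _ (Or.inr (Or.inl ⟨k, i, rfl⟩))
    rw [RR_not, RR_ap2] at this
    exact this
  have h2 : ∀ k i, ¬ R2 (nearF C.δ C.lt k) b (a i) := fun k i => by
    have := hall _ (Or.inr (Or.inr ⟨k, i, rfl⟩))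
    rw [RR_not, RR_ap2] at this
    exact this
  obtain ⟨S, hS⟩ := RR_support.{u, v, _} θ
  let F : Finset I := S.preimage Sum.inl Sum.inl_injective.injOn
  let f : Fin F.card ↪o I := F.orderEmbOfFin rfl
  have hf : ∀ i ∈ F, ∃ s, f s = i := by
    intro i hi
    have : i ∈ Set.range f := by
      rw [Finset.range_orderEmbOfFin]; exact hi
    exact this
  let g : I ⊕ Unit → Fin F.card ⊕ Unit := Sum.elim
    (fun i => if h : i ∈ F then Sum.inl (hf i h).choose else Sum.inr ()) (fun _ => Sum.inr ())
  have hg : ∀ x : Fin d → N, RR (ren g θ) (Sum.elim (fun s => a (f s)) (fun _ => x)) ↔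
      RR θ (Sum.elim a (fun _ => x)) := by
    intro x
    rw [RR_ren]
    refine hS N _ _ ?_
    rintro (i | i) hi
    · have h : i ∈ F := by simpa [F] using hi
      simp only [g, Function.comp_apply, Sum.elim_inl, h, dite_true]
      rw [(hf i h).choose_spec]
    · rfl
  obtain ⟨b', h3, h4⟩ := C.nonisol_fin hEM f (ren g θ) b ((hg b).2 hb) hP h1 h2
  rw [hg] at h3
  rcases h4 with ⟨k, hk⟩ | ⟨k, s, hk⟩
  · refine ⟨_, Or.inl ⟨_, C.ev1_low k, rfl⟩, b', h3, ?_⟩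
    rw [RR_ap1]
    unfold R1
    rw [RR_not, not_not]
    exact hk
  · refine ⟨_, Or.inr (Or.inl ⟨k, f s, rfl⟩), b', h3, ?_⟩
    rw [RR_not, RR_ap2, not_not]
    exact hk

theorem case1 (hL : L.card ≤ ℵ₀) [Infinite M] (I : Type) [LinearOrder I] [Countable I] :
    ∃ (_ : L.Structure ℕ) (a : I → Fin d → ℕ), C.IsEM a ∧ ∀ x : Fin d → ℕ, C.PP x →
      ∃ i k, R2 (nearF C.δ C.lt k) (a i) x ∨ R2 (nearF C.δ C.lt k) x (a i) := by
  obtain ⟨N, _, _, a, ha⟩ := C.exists_EM I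
  have : Infinite N := infinite_of_sen (N := M) (fun σ hσ => ha.sen C σ hσ)
  obtain ⟨i0, a', h1, h2⟩ := avoid_TF hL a (C.qq I) (by
    rintro θ ⟨b, hb⟩
    exact C.nonisol ha θ b hb)
  refine ⟨i0, a', fun n i σ hσ => ?_, fun x hx => ?_⟩
  · have := ha n i σ hσ
    have h3 : RR (ren i σ) a := (RR_ren _ _ _).2 this
    rw [h1, RR_ren] at h3
    exact h3
  · obtain ⟨ψ, (⟨ψ', hψ, rfl⟩ | ⟨k, i, rfl⟩ | ⟨k, i, rfl⟩), h⟩ := h2 x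
    · rw [RR_ap1] at h
      exact (h (hx _ hψ)).elim
    · rw [RR_not, RR_ap2, not_not] at h
      exact ⟨i, k, Or.inl h⟩
    · rw [RR_not, RR_ap2, not_not] at h
      exact ⟨i, k, Or.inr h⟩

end Chain
end PaperDef

namespace PaperDef

section decode_abs
variable {α : Type*} (D P : α → Prop) (lt S : α → α → Prop)

/-- the connectedness relation -/
def EE (S : α → α → Prop) : α → α → Prop := Relation.ReflTransGen (fun x y => S x y ∨ S y x)

theorem EE_symm {S : α → α → Prop} {x y : α} (h : EE S x y) : EE S y x := by
  unfold EE at *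
  induction h with
  | refl => exact .refl
  | tail _ h2 ih => exact Relation.ReflTransGen.head h2.symm ih

theorem EE_trans {S : α → α → Prop} {x y z : α} (h : EE S x y) (h' : EE S y z) : EE S x z :=
  Relation.ReflTransGen.trans h h'

theorem EE_of {S : α → α → Prop} {x y : α} (h : Relation.ReflTransGen S x y) : EE S x y :=
  Relation.ReflTransGen.mono (fun _ _ h => Or.inl h) _ _ h

theorem EE_split
    (irr : ∀ x, D x → ¬ lt x x)
    (tr : ∀ x y z, D x → D y → D z → lt x y → lt y z → lt x z)
    (tot : ∀ x y, D x → D y → x = y ∨ lt x y ∨ lt y x)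
    (hS : ∀ x y, S x y ↔ (D x ∧ D y) ∧ lt x y ∧ ∀ z, D z → lt x z → lt z y → False)
    {x y : α} (h : EE S x y) :
    Relation.ReflTransGen S x y ∨ Relation.ReflTransGen S y x := by
  have ru : ∀ x y z, S x y → S x z → y = z := by
    intro x y z h1 h2
    rw [hS] at h1 h2
    rcases tot y z h1.1.2 h2.1.2 with h | h | h
    · exact h
    · exact (h2.2.2 _ h1.1.2 h1.2.1 h).elim
    · exact (h1.2.2 _ h2.1.2 h2.2.1 h).elim
  have lu : ∀ x y z, S y x → S z x → y = z := by
    intro x y z h1 h2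
    rw [hS] at h1 h2
    rcases tot y z h1.1.1 h2.1.1 with h | h | h
    · exact h
    · exact (h1.2.2 _ h2.1.1 h h2.2.1).elim
    · exact (h2.2.2 _ h1.1.1 h h1.2.1).elim
  unfold EE at h
  induction h with
  | refl => exact Or.inl .refl
  | @tail y z _ h2 ih =>
    rcases h2 with h2 | h2
    · rcases ih with ih | ih
      · exact Or.inl (ih.tail h2)
      · rcases ih.cases_head with rfl | ⟨w, h3, h4⟩
        · exact Or.inl (.single h2)
        · rw [ru _ _ _ h2 h3]; exact Or.inr h4
    · rcases ih with ih | ih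
      · rcases ih.cases_tail with rfl | ⟨w, h3, h4⟩
        · exact Or.inr (.single h2)
        · rw [lu _ _ _ h2 h4]; exact Or.inl h3
      · exact Or.inr (ih.head h2)

theorem EE_lt
    (irr : ∀ x, D x → ¬ lt x x)
    (tr : ∀ x y z, D x → D y → D z → lt x y → lt y z → lt x z)
    (tot : ∀ x y, D x → D y → x = y ∨ lt x y ∨ lt y x)
    (hS : ∀ x y, S x y ↔ (D x ∧ D y) ∧ lt x y ∧ ∀ z, D z → lt x z → lt z y → False)
    {x y : α} (hx : D x) (h : EE S x y) (hl : lt x y) : Relation.ReflTransGen S x y := by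
  rcases EE_split D lt S irr tr tot hS h with h | h
  · exact h
  · exfalso
    have : ∀ z, Relation.ReflTransGen S z x → D z → z = x ∨ lt z x := by
      intro z hz
      induction hz using Relation.ReflTransGen.head_induction_on with
      | refl => exact fun _ => Or.inl rfl
      | head h1 _ ih =>
        intro hD
        rw [hS] at h1
        rcases ih h1.1.2 with rfl | h3
        · exact Or.inr h1.2.1
        · exact Or.inr (tr _ _ _ hD h1.1.2 hx h1.2.1 h3)
    have hD : D y := by
      rcases h.cases_head with rfl | ⟨w, h3, h4⟩
      · exact hx
      · exact ((hS _ _).1 h3).1.1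
    rcases this y h hD with rfl | h3
    · exact irr _ hD hl
    · exact irr _ hx (tr _ _ _ hx hD hx hl h3)

theorem EE_below
    (irr : ∀ x, D x → ¬ lt x x)
    (tr : ∀ x y z, D x → D y → D z → lt x y → lt y z → lt x z)
    (tot : ∀ x y, D x → D y → x = y ∨ lt x y ∨ lt y x)
    (hS : ∀ x y, S x y ↔ (D x ∧ D y) ∧ lt x y ∧ ∀ z, D z → lt x z → lt z y → False)
    {x z u : α} (hx : D x) (hz : D z) (hl : lt x z) (hn : ¬ EE S x z)
    (h : EE S x u) : D u ∧ lt u z := by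
  have h0 := h
  unfold EE at h
  induction h with
  | refl => exact ⟨hx, hl⟩
  | @tail y w h1 h2 ih =>
    obtain ⟨hy, hyz⟩ := ih h1
    rcases h2 with h2 | h2 <;> rw [hS] at h2
    · refine ⟨h2.1.2, ?_⟩
      rcases tot w z h2.1.2 hz with rfl | h | h
      · exact (hn h0).elim
      · exact h
      · exact (h2.2.2 _ hz hyz h).elim
    · exact ⟨h2.1.1, tr _ _ _ h2.1.1 hy hz h2.2.1 hyz⟩

theorem EE_above
    (irr : ∀ x, D x → ¬ lt x x)
    (tr : ∀ x y z, D x → D y → D z → lt x y → lt y z → lt x z)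
    (tot : ∀ x y, D x → D y → x = y ∨ lt x y ∨ lt y x)
    (hS : ∀ x y, S x y ↔ (D x ∧ D y) ∧ lt x y ∧ ∀ z, D z → lt x z → lt z y → False)
    {x z u : α} (hx : D x) (hz : D z) (hl : lt z x) (hn : ¬ EE S x z)
    (h : EE S x u) : D u ∧ lt z u := by
  have h0 := h
  unfold EE at h
  induction h with
  | refl => exact ⟨hx, hl⟩
  | @tail y w h1 h2 ih =>
    obtain ⟨hy, hyz⟩ := ih h1
    rcases h2 with h2 | h2 <;> rw [hS] at h2
    · exact ⟨h2.1.2, tr _ _ _ hz hy h2.1.2 hyz h2.2.1⟩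
    · refine ⟨h2.1.1, ?_⟩
      rcases tot w z h2.1.1 hz with rfl | h | h
      · exact (hn h0).elim
      · exact (h2.2.2 _ hz h hyz).elim
      · exact h

theorem decode_abs
    (irr : ∀ x, D x → ¬ lt x x)
    (tr : ∀ x y z, D x → D y → D z → lt x y → lt y z → lt x z)
    (tot : ∀ x y, D x → D y → x = y ∨ lt x y ∨ lt y x)
    (hS : ∀ x y, S x y ↔ (D x ∧ D y) ∧ lt x y ∧ ∀ z, D z → lt x z → lt z y → False)
    (hPD : ∀ x, P x → D x) {I J : Type} [LinearOrder I] [LinearOrder J]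
    (a : I → α) (b : J → α) (haP : ∀ i, P (a i)) (hbP : ∀ i, P (b i))
    (hal : ∀ i j, i < j → lt (a i) (a j)) (hbl : ∀ i j, i < j → lt (b i) (b j))
    (han : ∀ i j, i < j → ¬ Relation.ReflTransGen S (a i) (a j))
    (hbn : ∀ i j, i < j → ¬ Relation.ReflTransGen S (b i) (b j))
    (hac : ∀ x, P x → ∃ i, Relation.ReflTransGen S (a i) x ∨ Relation.ReflTransGen S x (a i))
    (hbc : ∀ x, P x → ∃ i, Relation.ReflTransGen S (b i) x ∨ Relation.ReflTransGen S x (b i)) :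
    Nonempty (I ≃o J) := by
  have han' : ∀ i j, i < j → ¬ EE S (a i) (a j) := fun i j hij h =>
    han i j hij (EE_lt D lt S irr tr tot hS (hPD _ (haP _)) h (hal _ _ hij))
  have hbn' : ∀ i j, i < j → ¬ EE S (b i) (b j) := fun i j hij h =>
    hbn i j hij (EE_lt D lt S irr tr tot hS (hPD _ (hbP _)) h (hbl _ _ hij))
  have h1 : ∀ i, ∃ j, EE S (a i) (b j) := by
    intro i
    obtain ⟨j, h | h⟩ := hbc _ (haP i)
    · exact ⟨j, EE_symm (EE_of h)⟩
    · exact ⟨j, EE_of h⟩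
  have h2 : ∀ j, ∃ i, EE S (b j) (a i) := by
    intro i
    obtain ⟨j, h | h⟩ := hac _ (hbP i)
    · exact ⟨j, EE_symm (EE_of h)⟩
    · exact ⟨j, EE_of h⟩
  choose f hf using h1
  choose g hg using h2
  have hmono : StrictMono f := by
    intro i i' hii
    have e1 := EE_below D lt S irr tr tot hS (hPD _ (haP _)) (hPD _ (haP _)) (hal _ _ hii)
      (han' _ _ hii) (hf i)
    have e2 := EE_above D lt S irr tr tot hS (hPD _ (haP _)) e1.1 e1.2
      (fun h => han' _ _ hii (EE_symm (EE_trans h (EE_symm (hf i))))) (hf i')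
    by_contra hn
    rcases (not_lt.1 hn).eq_or_lt with h | h
    · rw [h] at e2; exact irr _ e1.1 e2.2
    · exact irr _ e1.1 (tr _ _ _ e1.1 e2.1 e1.1 e2.2 (hbl _ _ h))
  refine ⟨hmono.orderIsoOfRightInverse f g ?_⟩
  intro j
  have h := EE_trans (hg j) (hf (g j))
  rcases lt_trichotomy (f (g j)) j with h3 | h3 | h3
  · exact (hbn' _ _ h3 (EE_symm h)).elim
  · exact h3
  · exact (hbn' _ _ h3 h).elim

end decode_abs

section near
variable {L : FirstOrder.Language.{u, v}} {N : Type w} [L.Structure N] {d : ℕ}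
  (δ : TF L d Unit) (lt : TF L d (Fin 2))

theorem near_rtg {k : ℕ} {x y : Fin d → N} (h : R2 (nearF δ lt k) x y) :
    Relation.ReflTransGen (R2 (sucF δ lt)) x y := by
  induction k generalizing y with
  | zero => rw [((R2_near_zero _ _ _ _).1 h).2]
  | succ k ih =>
    rcases (R2_near_succ _ _ _ _ _).1 h with h | ⟨z, h1, h2⟩
    · exact ih h
    · exact (ih h1).tail h2

theorem rtg_near {x y : Fin d → N} (hx : R1 δ x) (h : Relation.ReflTransGen (R2 (sucF δ lt)) x y) :
    ∃ k, R2 (nearF δ lt k) x y := by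
  induction h with
  | refl => exact ⟨0, (R2_near_zero _ _ _ _).2 ⟨hx, rfl⟩⟩
  | tail _ h2 ih =>
    obtain ⟨k, hk⟩ := ih
    exact ⟨k + 1, (R2_near_succ _ _ _ _ _).2 (Or.inr ⟨_, hk, h2⟩)⟩

end near

namespace Chain

variable {L : FirstOrder.Language.{u, v}} {M : Type w} [L.Structure M] {d : ℕ} (C : Chain L M d)

theorem decode {N N' : Type} [L.Structure N] [L.Structure N'] (e : N ≃[L] N')
    {I J : Type} [LinearOrder I] [LinearOrder J] (a : I → Fin d → N) (b : J → Fin d → N')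
    (ha : C.IsEM a) (hb : C.IsEM b)
    (hac : ∀ x : Fin d → N, C.PP x →
      ∃ i k, R2 (nearF C.δ C.lt k) (a i) x ∨ R2 (nearF C.δ C.lt k) x (a i))
    (hbc : ∀ x : Fin d → N', C.PP x →
      ∃ i k, R2 (nearF C.δ C.lt k) (b i) x ∨ R2 (nearF C.δ C.lt k) x (b i)) :
    Nonempty (I ≃o J) := by
  have lin := ha.lin C
  let b' : J → Fin d → N := fun j k => e.symm (b j k)
  have hb' : C.IsEM b' := by
    intro n i σ hσ
    exact (RR_equiv e.symm σ (fun j => b (i j))).2 (hb n i σ hσ)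
  have hbc' : ∀ x : Fin d → N, C.PP x →
      ∃ i k, R2 (nearF C.δ C.lt k) (b' i) x ∨ R2 (nearF C.δ C.lt k) x (b' i) := by
    intro x hx
    obtain ⟨i, k, h⟩ := hbc (fun k => e (x k)) (fun ψ hψ => (R1_equiv e ψ x).2 (hx ψ hψ))
    have e1 : x = fun k => e.symm ((fun k => e (x k)) k) := by
      ext k; simp
    refine ⟨i, k, ?_⟩
    rw [e1]
    exact h.imp (fun h => (R2_equiv e.symm _ _ _).2 h) (fun h => (R2_equiv e.symm _ _ _).2 h)
  have cov : ∀ {I : Type} (a : I → Fin d → N), (∀ x : Fin d → N, C.PP x →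
      ∃ i k, R2 (nearF C.δ C.lt k) (a i) x ∨ R2 (nearF C.δ C.lt k) x (a i)) →
      ∀ x, C.PP x → ∃ i, Relation.ReflTransGen (R2 (sucF C.δ C.lt)) (a i) x ∨
        Relation.ReflTransGen (R2 (sucF C.δ C.lt)) x (a i) := by
    intro I a h x hx
    obtain ⟨i, k, h⟩ := h x hx
    exact ⟨i, h.imp (near_rtg _ _) (near_rtg _ _)⟩
  have nr : ∀ {I : Type} [LinearOrder I] (a : I → Fin d → N), C.IsEM a → ∀ i j, i < j →
      ¬ Relation.ReflTransGen (R2 (sucF C.δ C.lt)) (a i) (a j) := by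
    intro I _ a ha i j hij h
    obtain ⟨k, hk⟩ := rtg_near _ _ (ha.PP C i _ C.ev1_D) h
    exact ha.not_near C hij k hk
  exact decode_abs (R1 C.δ) C.PP (R2 C.lt) (R2 (sucF C.δ C.lt)) lin.irr lin.tr lin.tot
    (fun x y => R2_suc _ _ _ _) (fun x hx => hx _ C.ev1_D) a b' (ha.PP C) (hb'.PP C)
    (fun _ _ => ha.lt C) (fun _ _ => hb'.lt C) (nr a ha) (nr b' hb') (cov a hac) (cov b' hbc')

end Chain
end PaperDef

namespace PaperDef

/-- the linear order coded by a set of naturals -/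
abbrev Iord (s : Set ℕ) : Type :=
  {x : ℚ // (∃ n : ℕ, x = n) ∨ ∃ n ∈ s, ((2 * n + 1 : ℕ) : ℚ) < x ∧ x < ((2 * n + 2 : ℕ) : ℚ)}

/-- the integer points -/
def Ipt (s : Set ℕ) (n : ℕ) : Iord s := ⟨n, Or.inl ⟨n, rfl⟩⟩

theorem Ipt_mono (s : Set ℕ) : StrictMono (Ipt s) := by
  intro a b h
  show (a : ℚ) < b
  exact_mod_cast h

theorem Ipt_cov {s : Set ℕ} {n : ℕ} (h : ∀ m ∈ s, n ≠ 2 * m + 1) : Ipt s n ⋖ Ipt s (n + 1) := by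
  refine ⟨Ipt_mono s (by omega), ?_⟩
  rintro ⟨c, hc⟩ g1 g2
  have h1 : (n : ℚ) < c := g1
  have h2 : c < ((n + 1 : ℕ) : ℚ) := g2
  clear g1 g2
  rcases hc with ⟨k, rfl⟩ | ⟨m, hm, h3, h4⟩
  · have h1 : n < k := by exact_mod_cast h1
    have h2 : k < n + 1 := by exact_mod_cast h2
    omega
  · have h5 : ((2 * m + 1 : ℕ) : ℚ) < ((n + 1 : ℕ) : ℚ) := h3.trans h2
    have h6 : (n : ℚ) < ((2 * m + 2 : ℕ) : ℚ) := h1.trans h4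
    have h5 : 2 * m + 1 < n + 1 := by exact_mod_cast h5
    have h6 : n < 2 * m + 2 := by exact_mod_cast h6
    exact h m hm (by omega)

theorem Ipt_not_cov {s : Set ℕ} {n : ℕ} (h : n ∈ s) :
    ¬ Ipt s (2 * n + 1) ⋖ Ipt s (2 * n + 2) := by
  intro hc
  have h1 : ((2 * n + 1 : ℕ) : ℚ) < (2 * n + 1 : ℕ) + 1 / 2 := by linarith
  have h2 : ((2 * n + 1 : ℕ) : ℚ) + 1 / 2 < (2 * n + 2 : ℕ) := by push_cast; linarith
  exact hc.2 (c := ⟨((2 * n + 1 : ℕ) : ℚ) + 1 / 2, Or.inr ⟨n, h, h1, h2⟩⟩) h1 h2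

theorem Ipt_range {s : Set ℕ} (x : Iord s) : (∃ n, x = Ipt s n) ↔ ∃ y, x ⋖ y ∨ y ⋖ x := by
  constructor
  · rintro ⟨n, rfl⟩
    rcases Nat.even_or_odd' n with ⟨m, rfl | rfl⟩
    · exact ⟨_, Or.inl (Ipt_cov (fun k _ => by omega))⟩
    · exact ⟨_, Or.inr (Ipt_cov (fun k _ => by omega))⟩
  · obtain ⟨x, hx⟩ := x
    rcases hx with ⟨k, rfl⟩ | ⟨m, hm, h3, h4⟩
    · exact fun _ => ⟨k, rfl⟩
    · rintro ⟨⟨y, hy⟩, h | h⟩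
      · exfalso
        have h1 : x < y := h.1
        obtain ⟨z, hz1, hz2⟩ := exists_between (lt_min h1 h4)
        exact h.2 (c := ⟨z, Or.inr ⟨m, hm, h3.trans hz1, hz2.trans_le (min_le_right _ _)⟩⟩) hz1
          (hz2.trans_le (min_le_left _ _))
      · exfalso
        have h1 : y < x := h.1
        obtain ⟨z, hz1, hz2⟩ := exists_between (max_lt h1 h3)
        have h5 := lt_of_le_of_lt (le_max_right y _) hz1
        have h6 := lt_of_le_of_lt (le_max_left y _) hz1
        exact h.2 (c := ⟨z, Or.inr ⟨m, hm, h5, hz2.trans h4⟩⟩) h6 hz2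

theorem Iord_inj {s t : Set ℕ} (e : Iord s ≃o Iord t) : s = t := by
  have h1 : ∀ {s t : Set ℕ} (e : Iord s ≃o Iord t) (n : ℕ), ∃ m, e (Ipt s n) = Ipt t m := by
    intro s t e n
    rw [Ipt_range]
    obtain ⟨y, hy⟩ := (Ipt_range _).1 ⟨n, rfl⟩
    exact ⟨e y, by simpa using hy⟩
  choose f hf using h1 e
  choose g hg using h1 e.symm
  have hmono : StrictMono f := by
    intro a b hab
    have := e.strictMono (Ipt_mono s hab)
    rw [hf, hf] at this
    exact (Ipt_mono t).lt_iff_lt.1 this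
  have hright : Function.RightInverse g f := by
    intro m
    have : e (e.symm (Ipt t m)) = Ipt t (f (g m)) := by rw [hg, hf]
    rw [OrderIso.apply_symm_apply] at this
    exact ((Ipt_mono t).injective this).symm
  have hid : ∀ n, f n = n := by
    intro n
    have : hmono.orderIsoOfRightInverse f g hright = OrderIso.refl ℕ := Subsingleton.elim _ _
    exact DFunLike.congr_fun this n
  have key : ∀ n, Ipt s (2 * n + 1) ⋖ Ipt s (2 * n + 2) ↔ Ipt t (2 * n + 1) ⋖ Ipt t (2 * n + 2) := by
    intro n
    have h2 := hf (2 * n + 1)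
    have h3 := hf (2 * n + 2)
    rw [hid] at h2 h3
    rw [← h2, ← h3]
    simp
  have key2 : ∀ {s : Set ℕ} (n : ℕ), n ∈ s ↔ ¬ Ipt s (2 * n + 1) ⋖ Ipt s (2 * n + 2) := by
    intro s n
    refine ⟨Ipt_not_cov, fun h => ?_⟩
    by_contra hn
    refine h (Ipt_cov (fun m hm h => hn ?_))
    obtain rfl : n = m := by omega
    exact hm
  ext n
  rw [key2, key2, key]

end PaperDef

namespace PaperDef

/-- many models with finitely many named constants -/
def Good (L : FirstOrder.Language.{u, v}) (M : Type w) [L.Structure M] : Prop :=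
  ∃ (K : Type) (_ : Finite K) (str : Set ℕ → L.Structure ℕ) (b : Set ℕ → K → ℕ),
    (∀ s (σ : L.Sentence), M ⊨ σ → @Sentence.Realize L ℕ (str s) σ) ∧
    ∀ s t, (∃ e : @FirstOrder.Language.Equiv L ℕ ℕ (str s) (str t),
      ∀ k, (@FirstOrder.Language.Equiv.toEquiv L ℕ ℕ (str s) (str t) e) (b s k) = b t k) → s = t

section
variable {L : FirstOrder.Language.{u, v}} {M : Type w} [L.Structure M] {d : ℕ}

theorem Chain.good (C : Chain L M d) (hL : L.card ≤ ℵ₀) [Infinite M] : Good L M := by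
  choose str a ha hc using fun s : Set ℕ => C.case1 hL (Iord s)
  refine ⟨Empty, inferInstance, str, fun _ => Empty.elim, fun s σ hσ => ?_, ?_⟩
  · let _ := str s
    exact (ha s).sen C σ hσ
  · rintro s t ⟨e, -⟩
    obtain ⟨f⟩ := @Chain.decode L M _ d C ℕ ℕ (str s) (str t) e _ _ _ _ (a s) (a t) (ha s) (ha t)
      (hc s) (hc t)
    exact Iord_inj f

/-- infinite trace -/
def InfTr (c : ℕ → Fin d → M) (θ : TF L d Unit) : Prop := {i | R1 θ (c i)}.Infinite

/-- the tree of formulas -/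
noncomputable def treeF (c : ℕ → Fin d → M) (η : TF L d Unit → TF L d Unit) : List Bool → TF L d Unit
  | [] => teq () ()
  | b :: l => tand (treeF c η l) (if b then η (treeF c η l) else tnot (η (treeF c η l)))

open Classical in
/-- initial segments of the characteristic function -/
noncomputable def path (s : Set ℕ) : ℕ → List Bool
  | 0 => []
  | n + 1 => decide (n ∈ s) :: path s n

theorem case2 (hL : L.card ≤ ℵ₀) [Infinite M] (c : ℕ → Fin d → M)
    (h : ∀ θ : TF L d Unit, InfTr c θ → ∃ η : TF L d Unit, InfTr c (tand θ η) ∧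
      InfTr c (tand θ (tnot η))) : Good L M := by
  classical
  have : ∀ θ : TF L d Unit, ∃ η : TF L d Unit, InfTr c θ → InfTr c (tand θ η) ∧
      InfTr c (tand θ (tnot η)) := by
    intro θ
    by_cases hθ : InfTr c θ
    · obtain ⟨η, hη⟩ := h θ hθ
      exact ⟨η, fun _ => hη⟩
    · exact ⟨θ, fun h => absurd h hθ⟩
  choose η hη using this
  have htree : ∀ l, InfTr c (treeF c η l) := by
    intro l
    induction l with
    | nil =>
      have : {i | R1 (treeF c η []) (c i)} = Set.univ := by
        ext i
        simp [treeF, R1, RR_eq]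
      unfold InfTr
      rw [this]
      exact Set.infinite_univ
    | cons b l ih =>
      cases b
      · exact (hη _ ih).2
      · exact (hη _ ih).1
  let Γ : Set ℕ → Set (TF L d Unit) := fun s =>
    {φ | (∃ n, φ = treeF c η (path s n)) ∨ ∃ σ : L.Sentence, M ⊨ σ ∧ φ = sen σ}
  have hmon : ∀ (s : Set ℕ) (n m : ℕ) (x : Fin d → M), R1 (treeF c η (path s (n + m))) x →
      R1 (treeF c η (path s n)) x := by
    intro s n m x
    induction m with
    | zero => exact id
    | succ m ih =>
      intro h
      have h : R1 (tand (treeF c η (path s (n + m))) _) x := h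
      unfold R1 at h
      rw [RR_and] at h
      exact ih h.1
  have hfin : ∀ s (F : Finset (TF L d Unit)), (F : Set _) ⊆ Γ s →
      ∃ n, ∀ x : Fin d → M, R1 (treeF c η (path s n)) x → ∀ φ ∈ F, R1 φ x := by
    intro s F hF
    induction F using Finset.induction_on with
    | empty => exact ⟨0, by simp⟩
    | insert φ F hφ ih =>
      obtain ⟨n, hn⟩ := ih (fun z hz => hF (by simp [Finset.mem_coe.1 hz]))
      rcases hF (show φ ∈ _ by simp) with ⟨m, rfl⟩ | ⟨σ, hσ, rfl⟩
      · refine ⟨n + m, fun x hx φ hφ => ?_⟩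
        rcases Finset.mem_insert.1 hφ with rfl | hφ
        · rw [add_comm] at hx; exact hmon _ _ _ _ hx
        · exact hn x (hmon _ _ _ _ hx) φ hφ
      · refine ⟨n, fun x hx φ hφ => ?_⟩
        rcases Finset.mem_insert.1 hφ with rfl | hφ
        · exact (RR_sen _ _).2 hσ
        · exact hn x hx φ hφ
  have hmod : ∀ s : Set ℕ, ∃ (_ : L.Structure ℕ) (x : Fin d → ℕ), ∀ φ ∈ Γ s, R1 φ x := by
    intro s
    obtain ⟨N, _, _, a, ha⟩ := ext_TF (M := M) (Γ s) (by
      intro F hF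
      obtain ⟨n, hn⟩ := hfin s F hF
      obtain ⟨i, hi⟩ := (htree (path s n)).nonempty
      exact ⟨fun _ => c i, fun φ hφ => hn _ hi φ hφ⟩)
    have : Infinite N := infinite_of_sen (N := M)
      (fun σ hσ => (RR_sen _ _).1 (ha (sen σ) (Or.inr ⟨σ, hσ, rfl⟩)))
    obtain ⟨i0, a', h1, -⟩ := avoid_TF hL a {tnot (teq (Sum.inr ()) (Sum.inr ()))} (by
      rintro θ ⟨x, hx⟩
      exact ⟨_, rfl, x, hx, by rw [RR_not, RR_eq]; simp⟩)
    exact ⟨i0, a' (), fun φ hφ => (h1 φ).1 (ha φ hφ)⟩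
  choose str b hb using hmod
  refine ⟨Fin d, inferInstance, str, b, fun s σ hσ => ?_, ?_⟩
  · exact (@RR_sen L ℕ (str s) d Unit σ (fun _ => b s)).1 (hb s _ (Or.inr ⟨σ, hσ, rfl⟩))
  · rintro s t ⟨e, he⟩
    have hst : ∀ n, @R1 L d ℕ (str s) (treeF c η (path t n)) (b s) := by
      intro n
      have h1 := hb t _ (Or.inl ⟨n, rfl⟩)
      have h2 := @R1_equiv L d ℕ (str s) ℕ (str t) e (treeF c η (path t n)) (b s)
      refine h2.1 ?_
      convert h1 using 1
      ext k
      exact he k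
    have hss : ∀ n, @R1 L d ℕ (str s) (treeF c η (path s n)) (b s) :=
      fun n => hb s _ (Or.inl ⟨n, rfl⟩)
    have hstep : ∀ n, path s n = path t n → (n ∈ s ↔ n ∈ t) := by
      intro n hn
      have h1 := hss (n + 1)
      have h2 := hst (n + 1)
      simp only [path, treeF] at h1 h2
      unfold R1 at h1 h2
      rw [@RR_and L d Unit ℕ (str s)] at h1 h2
      rw [← hn] at h2
      by_cases hs : n ∈ s <;> by_cases ht : n ∈ t
      · simp [hs, ht]
      · have h1 := h1.2
        have h2 := h2.2
        simp only [hs, ht, decide_true, decide_false, if_true, Bool.false_eq_true, if_false] at h1 h2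
        rw [@RR_not L d Unit ℕ (str s)] at h2
        exact (h2 h1).elim
      · have h1 := h1.2
        have h2 := h2.2
        simp only [hs, ht, decide_true, decide_false, if_true, Bool.false_eq_true, if_false] at h1 h2
        rw [@RR_not L d Unit ℕ (str s)] at h1
        exact (h1 h2).elim
      · simp [hs, ht]
    have hp : ∀ n, path s n = path t n := by
      intro n
      induction n with
      | zero => rfl
      | succ n ih => simp only [path, ih, hstep n ih]
    ext n
    exact hstep n (hp n)

end
end PaperDef

namespace PaperDef

section
variable {L : FirstOrder.Language.{u, v}} {M : Type w} [L.Structure M] {d : ℕ}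

theorem chain_good (hL : L.card ≤ ℵ₀) [Infinite M] (δ : TF L d Unit) (lt : TF L d (Fin 2))
    (lin : LinD δ lt M) (c : ℕ → Fin d → M) (cD : ∀ i, R1 δ (c i))
    (cmono : ∀ i j, i < j → R2 lt (c i) (c j))
    (cinit : ∀ x j, R1 δ x → R2 lt x (c j) → ∃ i, i < j ∧ x = c i) : Good L M := by
  classical
  by_cases hc : ∀ θ : TF L d Unit, InfTr c θ → ∃ η : TF L d Unit, InfTr c (tand θ η) ∧
      InfTr c (tand θ (tnot η))
  · exact case2 hL c hc
  push Not at hc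
  obtain ⟨θ, hθ, hη⟩ := hc
  let p : ℕ → Prop := fun i => R1 θ (c i)
  have hp : (setOf p).Infinite := hθ
  have hD : ∀ x : Fin d → M, R1 (tand δ θ) x ↔ R1 δ x ∧ R1 θ x := fun x => RR_and _ _ _
  let C : Chain L M d :=
    { δ := tand δ θ
      lt := lt
      lin :=
        { irr := fun x hx => lin.irr x ((hD x).1 hx).1
          tr := fun x y z hx hy hz => lin.tr x y z ((hD x).1 hx).1 ((hD y).1 hy).1 ((hD z).1 hz).1
          tot := fun x y hx hy => lin.tot x y ((hD x).1 hx).1 ((hD y).1 hy).1 }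
      c := fun i => c (Nat.nth p i)
      cD := fun i => (hD _).2 ⟨cD _, Nat.nth_mem_of_infinite hp i⟩
      cmono := fun i j hij => cmono _ _ (Nat.nth_strictMono hp hij)
      cinit := by
        intro x j hx hl
        obtain ⟨i, hi, rfl⟩ := cinit x _ ((hD x).1 hx).1 hl
        have hpi : p i := ((hD _).1 hx).2
        have h1 : Nat.nth p (Nat.count p i) = i := Nat.nth_count hpi
        refine ⟨Nat.count p i, ?_, by rw [h1]⟩
        rw [← h1] at hi
        exact (Nat.nth_strictMono hp).lt_iff_lt.1 hi
      simple := by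
        intro η
        have key : ∀ η : TF L d Unit, ¬ InfTr c (tand θ η) → ∃ k, ∀ z, k ≤ z →
            ¬ R1 η (c (Nat.nth p z)) := by
          intro η h
          obtain ⟨B, hB⟩ := (Set.not_infinite.1 h).bddAbove
          refine ⟨B + 1, fun z hz h1 => ?_⟩
          have h2 : Nat.nth p z ≤ B := hB ((RR_and _ _ _).2
            ⟨Nat.nth_mem_of_infinite hp z, h1⟩)
          have h3 := (Nat.nth_strictMono hp).id_le z
          have h3 : z ≤ Nat.nth p z := h3
          omega
        by_cases h : InfTr c (tand θ η)
        · obtain ⟨k, hk⟩ := key (tnot η) (hη η h)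
          refine ⟨k, Or.inl fun z hz => ?_⟩
          have := hk z hz
          unfold R1 at this
          rw [RR_not, not_not] at this
          exact this
        · obtain ⟨k, hk⟩ := key η h
          exact ⟨k, Or.inr hk⟩ }
  exact C.good hL

theorem disc_good (hL : L.card ≤ ℵ₀) [Infinite M] (δ : TF L d Unit) (lt : TF L d (Fin 2))
    (lin : LinD δ lt M) (a : Fin d → M) (ha : R1 δ a) (hmin : ∀ x, R1 δ x → x = a ∨ R2 lt a x)
    (hinf : {x | R1 δ x ∧ R2 lt a x}.Infinite)
    (hsuc : ∀ x : Fin d → M, R1 δ x → (∃ y, R1 δ y ∧ R2 lt x y) → ∃ y, R1 δ y ∧ R2 lt x y ∧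
      ∀ z, R1 δ z → R2 lt x z → z = y ∨ R2 lt y z) : Good L M := by
  classical
  have step : ∀ x : {x : Fin d → M // R1 δ x ∧ {y | R1 δ y ∧ R2 lt x y}.Infinite},
      ∃ y : {x : Fin d → M // R1 δ x ∧ {y | R1 δ y ∧ R2 lt x y}.Infinite},
        R2 lt x.1 y.1 ∧ ∀ z, R1 δ z → R2 lt x.1 z → z = y.1 ∨ R2 lt y.1 z := by
    rintro ⟨x, hx, hi⟩
    obtain ⟨y, hy, h1, h2⟩ := hsuc x hx hi.nonempty
    refine ⟨⟨y, hy, ?_⟩, h1, h2⟩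
    intro hfin
    refine hi ((hfin.insert y).subset ?_)
    rintro z ⟨hz, hxz⟩
    rcases h2 z hz hxz with h | h
    · exact Or.inl h
    · exact Or.inr ⟨hz, h⟩
  choose f hf1 hf2 using step
  let c' : ℕ → {x : Fin d → M // R1 δ x ∧ {y | R1 δ y ∧ R2 lt x y}.Infinite} := fun n =>
    f^[n] ⟨a, ha, hinf⟩
  have hc' : ∀ n, c' (n + 1) = f (c' n) := fun n => Function.iterate_succ_apply' f n _
  have cD : ∀ i, R1 δ (c' i).1 := fun i => (c' i).2.1
  refine chain_good hL δ lt lin (fun n => (c' n).1) cD ?_ ?_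
  · intro i j hij
    obtain ⟨k, rfl⟩ : ∃ k, j = i + 1 + k := ⟨j - (i + 1), by omega⟩
    clear hij
    induction k with
    | zero =>
      show R2 lt (c' i).1 (c' (i + 1)).1
      rw [hc']; exact hf1 _
    | succ k ih =>
      refine lin.tr _ _ _ (cD _) (cD _) (cD _) ih ?_
      show R2 lt (c' (i + 1 + k)).1 (c' (i + 1 + k + 1)).1
      rw [hc']; exact hf1 _
  · intro x j hx
    induction j with
    | zero =>
      intro h
      exfalso
      have h : R2 lt x a := h
      rcases hmin x hx with rfl | h2
      · exact lin.irr _ hx h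
      · exact lin.irr _ hx (lin.tr _ _ _ hx ha hx h h2)
    | succ j ih =>
      intro h
      rcases lin.tot x _ hx (cD j) with h1 | h1 | h1
      · exact ⟨j, by omega, h1⟩
      · obtain ⟨i, hi, e⟩ := ih h1
        exact ⟨i, by omega, e⟩
      · exfalso
        have h2 := hf2 _ _ hx h1
        rw [← hc'] at h2
        rcases h2 with rfl | h2
        · exact lin.irr _ hx h
        · exact lin.irr _ hx (lin.tr _ _ _ hx (cD _) hx h h2)

end

section cst
variable {L : FirstOrder.Language.{u, v}} {M : Type w} [L.Structure M] {d : ℕ} {A X : Type}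

/-- turning parameters into constants -/
noncomputable def cst (ψ : L.Formula (A ⊕ (X × Fin d))) : TF L[[A]] d X :=
  BoundedFormula.constantsVarsEquiv.symm ψ

theorem RR_cst (f : A → M) (ψ : L.Formula (A ⊕ (X × Fin d))) (x : X → Fin d → M) :
    letI := constantsOn.structure f
    RR (cst ψ) x ↔ ψ.Realize (Sum.elim f (fun p => x p.1 p.2)) := by
  letI := constantsOn.structure f
  show RR (cst ψ) x ↔ ψ.Realize (Sum.elim f (fun p => x p.1 p.2))
  unfold RR cst Formula.Realize
  rw [← BoundedFormula.realize_constantsVarsEquiv, _root_.Equiv.apply_symm_apply]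
  rfl

theorem half_good (hL : L.card ≤ ℵ₀) [Infinite M] {n m : ℕ}
    (δ : L.Formula (Fin n ⊕ Fin m)) (φ : L.Formula ((Fin n ⊕ Fin n) ⊕ Fin m))
    (c : Fin m → M) (D : Set (Fin n → M)) (hD : D = {x | δ.Realize (Sum.elim x c)})
    (r : (Fin n → M) → (Fin n → M) → Prop)
    (hr : r = fun x y => φ.Realize (Sum.elim (Sum.elim x y) c))
    (hlin : IsLinearOn r D)
    (hdisc : ∀ a ∈ D, (∃ b ∈ D, r a b) → ∃ b ∈ D, r a b ∧ ∀ c ∈ D, r a c → c = b ∨ r b c)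
    (a : Fin n → M) (ha : a ∈ D) (hinf : {x ∈ D | r a x}.Infinite) :
    letI := constantsOn.structure (Sum.elim c a)
    Good L[[Fin m ⊕ Fin n]] M := by
  let _ := constantsOn.structure (Sum.elim c a)
  show Good L[[Fin m ⊕ Fin n]] M
  let δ0 : TF L[[Fin m ⊕ Fin n]] n Unit := cst (Formula.relabel
    (Sum.elim (fun k => Sum.inr ((), k)) (fun k => Sum.inl (Sum.inl k))) δ)
  let e0 : TF L[[Fin m ⊕ Fin n]] n Unit := cst (Formula.iInf (fun k : Fin n => Term.equal
    (Term.var (Sum.inr ((), k))) (Term.var (Sum.inl (Sum.inr k)))))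
  let l0 : TF L[[Fin m ⊕ Fin n]] n Unit := cst (Formula.relabel
    (Sum.elim (Sum.elim (fun k => Sum.inl (Sum.inr k)) (fun k => Sum.inr ((), k)))
      (fun k => Sum.inl (Sum.inl k))) φ)
  let lt : TF L[[Fin m ⊕ Fin n]] n (Fin 2) := cst (Formula.relabel
    (Sum.elim (Sum.elim (fun k => Sum.inr (0, k)) (fun k => Sum.inr (1, k)))
      (fun k => Sum.inl (Sum.inl k))) φ)
  have hδ0 : ∀ x, R1 δ0 x ↔ x ∈ D := by
    intro x
    unfold R1
    rw [RR_cst, Formula.realize_relabel, hD]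
    apply iff_of_eq
    show _ = δ.Realize (Sum.elim x c)
    congr 1; ext (k | k) <;> rfl
  have he0 : ∀ x, R1 e0 x ↔ x = a := by
    intro x
    unfold R1
    rw [RR_cst, Formula.realize_iInf]
    simp only [Formula.realize_equal, Term.realize_var, Sum.elim_inl, Sum.elim_inr]
    exact funext_iff.symm
  have hl0 : ∀ x, R1 l0 x ↔ r a x := by
    intro x
    unfold R1
    rw [RR_cst, Formula.realize_relabel, hr]
    apply iff_of_eq
    show _ = φ.Realize _
    congr 1; ext ((k | k) | k) <;> rfl
  have hlt : ∀ x y, R2 lt x y ↔ r x y := by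
    intro x y
    unfold R2
    rw [RR_cst, Formula.realize_relabel, hr]
    apply iff_of_eq
    show _ = φ.Realize _
    congr 1; ext ((k | k) | k) <;> rfl
  have hδ : ∀ x, R1 (tand δ0 (tor e0 l0)) x ↔ x ∈ D ∧ (x = a ∨ r a x) := by
    intro x
    rw [← hδ0, ← he0, ← hl0]
    unfold R1
    rw [RR_and, RR_or]
  have hL' : (L[[Fin m ⊕ Fin n]]).card ≤ ℵ₀ := by
    rw [card_withConstants]
    refine Cardinal.add_le_aleph0.2 ⟨by simpa using hL, by simp⟩
  refine disc_good hL' (tand δ0 (tor e0 l0)) lt ⟨?_, ?_, ?_⟩ a ?_ ?_ ?_ ?_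
  · intro x hx
    rw [hlt]
    exact hlin.1 x ((hδ x).1 hx).1
  · intro x y z hx hy hz
    rw [hlt, hlt, hlt]
    exact hlin.2.1 x ((hδ x).1 hx).1 y ((hδ y).1 hy).1 z ((hδ z).1 hz).1
  · intro x y hx hy
    rw [hlt, hlt]
    exact hlin.2.2 x ((hδ x).1 hx).1 y ((hδ y).1 hy).1
  · exact (hδ a).2 ⟨ha, Or.inl rfl⟩
  · intro x hx
    rw [hlt]
    exact ((hδ x).1 hx).2
  · refine hinf.mono ?_
    rintro x ⟨h1, h2⟩
    exact ⟨(hδ x).2 ⟨h1, Or.inr h2⟩, (hlt _ _).2 h2⟩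
  · rintro x hx ⟨y, hy, hxy⟩
    rw [hδ] at hx hy
    rw [hlt] at hxy
    obtain ⟨z, hz, h1, h2⟩ := hdisc x hx.1 ⟨y, hy.1, hxy⟩
    refine ⟨z, (hδ z).2 ⟨hz, Or.inr ?_⟩, (hlt _ _).2 h1, fun t ht hxt => ?_⟩
    · rcases hx.2 with rfl | h3
      · exact h1
      · exact hlin.2.1 _ ha _ hx.1 _ hz h3 h1
    · rw [hlt] at hxt ⊢
      exact h2 t ((hδ t).1 ht).1 hxt

theorem all_good (hL : L.card ≤ ℵ₀) [Infinite M] {n m : ℕ}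
    (δ : L.Formula (Fin n ⊕ Fin m)) (φ : L.Formula ((Fin n ⊕ Fin n) ⊕ Fin m))
    (c : Fin m → M) (D : Set (Fin n → M)) (hD : D = {x | δ.Realize (Sum.elim x c)})
    (r : (Fin n → M) → (Fin n → M) → Prop)
    (hr : r = fun x y => φ.Realize (Sum.elim (Sum.elim x y) c))
    (hDinf : D.Infinite)
    (hlin : IsLinearOn r D)
    (hdisc : IsDiscreteOn r D) :
    ∃ f : Fin m ⊕ Fin n → M,
    letI := constantsOn.structure f
    Good L[[Fin m ⊕ Fin n]] M := by
  obtain ⟨a, ha⟩ := hDinf.nonempty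
  refine ⟨Sum.elim c a, ?_⟩
  by_cases h : {x ∈ D | r a x}.Infinite
  · exact half_good hL δ φ c D hD r hr hlin hdisc.1 a ha h
  · have h2 : {x ∈ D | r x a}.Infinite := by
      intro h2
      refine hDinf (((Set.not_infinite.1 h).union h2).insert a |>.subset ?_)
      intro x hx
      rcases hlin.2.2 x hx a ha with h3 | h3 | h3
      · exact Or.inl h3
      · exact Or.inr (Or.inr ⟨hx, h3⟩)
      · exact Or.inr (Or.inl ⟨hx, h3⟩)
    refine half_good hL δ (Formula.relabel (Sum.map Sum.swap id) φ) c D hD (fun x y => r y x) ?_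
      ⟨hlin.1, fun x hx y hy z hz h1 h2 => hlin.2.1 z hz y hy x hx h2 h1, fun x hx y hy => ?_⟩
      hdisc.2 a ha h2
    · ext x y
      rw [hr, Formula.realize_relabel]
      apply iff_of_eq
      show φ.Realize _ = φ.Realize _
      congr 1; ext ((k | k) | k) <;> rfl
    · exact (hlin.2.2 x hx y hy).imp_right Or.symm

end cst
end PaperDef

namespace PaperDef

section up
variable {L : FirstOrder.Language.{u, v}} {A : Type}

/-- the reduct forgetting constants -/
@[reducible] def red (s : L[[A]].Structure ℕ) : L.Structure ℕ :=
  @LHom.reduct L L[[A]] (L.lhomWithConstants A) ℕ s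

/-- values of the constants -/
def cval (s : L[[A]].Structure ℕ) (a : A) : ℕ :=
  @Structure.funMap L[[A]] ℕ s 0 (Sum.inr a) Fin.elim0

theorem iso_up (s t : L[[A]].Structure ℕ)
    (e : @FirstOrder.Language.Equiv L ℕ ℕ (red s) (red t))
    (he : ∀ a, (@FirstOrder.Language.Equiv.toEquiv L ℕ ℕ (red s) (red t) e) (cval s a) = cval t a) :
    ∃ e' : @FirstOrder.Language.Equiv L[[A]] ℕ ℕ s t,
      @FirstOrder.Language.Equiv.toEquiv L[[A]] ℕ ℕ s t e' =
        @FirstOrder.Language.Equiv.toEquiv L ℕ ℕ (red s) (red t) e := by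
  refine ⟨@FirstOrder.Language.Equiv.mk L[[A]] ℕ ℕ s t
    (@FirstOrder.Language.Equiv.toEquiv L ℕ ℕ (red s) (red t) e) ?_ ?_, rfl⟩
  · rintro n (f | f) x
    · exact @FirstOrder.Language.Equiv.map_fun' L ℕ ℕ (red s) (red t) e n f x
    · cases n with
      | zero =>
        have h := he f
        unfold cval at h
        have h1 : x = Fin.elim0 := Subsingleton.elim _ _
        subst h1
        refine Eq.trans h ?_
        exact congrArg (@Structure.funMap L[[A]] ℕ t 0 (Sum.inr f)) (Subsingleton.elim _ _)
      | succ n => exact PEmpty.elim f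
  · rintro n (R | R) x
    · exact @FirstOrder.Language.Equiv.map_rel' L ℕ ℕ (red s) (red t) e n R x
    · exact Empty.elim R

theorem red_model {M : Type w} [L.Structure M] (f : A → M) (s : L[[A]].Structure ℕ)
    (h : letI := constantsOn.structure f
      ∀ σ : L[[A]].Sentence, M ⊨ σ → @Sentence.Realize L[[A]] ℕ s σ)
    (σ : L.Sentence) (hσ : M ⊨ σ) : @Sentence.Realize L ℕ (red s) σ := by
  let _ := constantsOn.structure f
  have h1 : M ⊨ (L.lhomWithConstants A).onSentence σ := (LHom.realize_onSentence M _ σ).2 hσ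
  have h2 := h _ h1
  exact (@LHom.realize_onSentence L L[[A]] ℕ (red s) s _ _ σ).1 h2

end up

section count
variable {L : FirstOrder.Language.{u, v}}

/-- the complete diagram of a structure on the naturals -/
def diag (s : L.Structure ℕ) : Set (L.Formula ℕ) := {φ | @Formula.Realize L ℕ s ℕ φ id}

theorem diag_inj {s t : L.Structure ℕ} (h : diag s = diag t) :
    Nonempty (@FirstOrder.Language.Equiv L ℕ ℕ s t) := by
  refine ⟨@FirstOrder.Language.Equiv.mk L ℕ ℕ s t (_root_.Equiv.refl ℕ) ?_ ?_⟩
  · intro n f x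
    let y := @Structure.funMap L ℕ s n f x
    have h1 : Term.equal (Term.func f (fun i => Term.var (x i))) (Term.var y) ∈ diag s := by
      show @Formula.Realize L ℕ s ℕ _ id
      rw [@Formula.realize_equal L ℕ s]
      rfl
    rw [h] at h1
    have h1 : @Formula.Realize L ℕ t ℕ _ id := h1
    rw [@Formula.realize_equal L ℕ t] at h1
    exact h1.symm
  · intro n R x
    have h1 : (R.formula (fun i => Term.var (x i)) : L.Formula ℕ) ∈ diag s ↔
        (R.formula (fun i => Term.var (x i)) : L.Formula ℕ) ∈ diag t := by rw [h]
    have h2 : (R.formula (fun i => Term.var (x i)) : L.Formula ℕ) ∈ diag s ↔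
        @Structure.RelMap L ℕ s n R x := @Formula.realize_rel L ℕ s ℕ id n R _
    have h3 : (R.formula (fun i => Term.var (x i)) : L.Formula ℕ) ∈ diag t ↔
        @Structure.RelMap L ℕ t n R x := @Formula.realize_rel L ℕ t ℕ id n R _
    rw [← h2, h1, h3]
    rfl

theorem card_upper (hL : L.card ≤ ℵ₀) (T : L.Theory) : numCountableModels T ≤ 2 ^ ℵ₀ := by
  have hex : ∀ q : Quotient (countableModelSetoid T), ∃ s : L.Structure ℕ,
      Nonempty (@FirstOrder.Language.Equiv L q.out.1 ℕ _ s) := by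
    intro q
    have := q.out.2.1
    have := q.out.2.2
    obtain ⟨e⟩ := nonempty_equiv_of_countable (α := q.out.1) (β := ℕ)
    exact ⟨e.inducedStructure, ⟨e.inducedStructureEquiv⟩⟩
  choose s hs using hex
  have := countable_formula hL ℕ
  obtain ⟨j, hj⟩ := exists_injective_nat (L.Formula ℕ)
  have hinj : Function.Injective (fun q => j '' (diag (s q))) := by
    intro q q' h
    have h1 := hj.image_injective h
    obtain ⟨e⟩ := diag_inj h1
    obtain ⟨e1⟩ := hs q
    obtain ⟨e2⟩ := hs q'
    rw [← q.out_eq, ← q'.out_eq]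
    apply Quotient.sound
    refine ⟨?_⟩
    exact @FirstOrder.Language.Equiv.comp L _ ℕ _ (s q') _ _
      (@FirstOrder.Language.Equiv.symm L _ _ _ (s q') e2)
      (@FirstOrder.Language.Equiv.comp L _ ℕ _ (s q) ℕ (s q') e e1)
  have := Cardinal.mk_le_of_injective (f := fun q => ULift.up.{max u v 1} (j '' (diag (s q))))
    (fun a b h => hinj (ULift.up_injective h))
  refine (show numCountableModels T ≤ _ from this).trans ?_
  simp

/-- the model given by a structure on the naturals -/
def mkMod (T : L.Theory) (s : L.Structure ℕ) (h : @Theory.Model L ℕ s T) :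
    {N : Theory.ModelType.{u, v, 0} T // Countable N ∧ Infinite N} :=
  ⟨@Theory.ModelType.mk L T ℕ s h inferInstance,
    (inferInstance : Countable ℕ), (inferInstance : Infinite ℕ)⟩

theorem card_lower {M : Type w} [L.Structure M] (T : L.Theory) (hMT : M ⊨ T)
    {A : Type} [Finite A] (f : A → M)
    (hg : letI := constantsOn.structure f
      Good L[[A]] M) : 2 ^ ℵ₀ ≤ numCountableModels T := by
  obtain ⟨K, _, str, b, h1, h2⟩ := hg
  have hmod : ∀ s, @Theory.Model L ℕ (red (str s)) T := by
    intro s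
    rw [@Theory.model_iff L ℕ (red (str s))]
    intro σ hσ
    exact red_model f (str s) (h1 s) σ (hMT.realize_of_mem σ hσ)
  let G : Set ℕ → Quotient (countableModelSetoid T) := fun s => Quotient.mk _ (mkMod T _ (hmod s))
  have hiso : ∀ s, Nonempty ((mkMod T _ (hmod s)).1 ≃[L] (G s).out.1) := by
    intro s
    have : (countableModelSetoid T).r (mkMod T _ (hmod s)) (G s).out := (countableModelSetoid T).iseqv.symm
      (@Quotient.mk_out _ (countableModelSetoid T) (mkMod T _ (hmod s)))
    exact this
  have hcount : ∀ q : Quotient (countableModelSetoid T), ∃ j : q.out.1 → ℕ,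
      Function.Injective j := fun q => by
    have := q.out.2.1
    exact exists_injective_nat _
  choose j hj using hcount
  let e : ∀ s, ((mkMod T _ (hmod s)).1 ≃[L] (G s).out.1) := fun s => (hiso s).some
  let tup : ∀ s, A ⊕ K → ℕ := fun s => Sum.elim (cval (str s)) (b s)
  let H : Set ℕ → Quotient (countableModelSetoid T) × (A ⊕ K → ℕ) := fun s =>
    (G s, fun k => j (G s) ((e s).toEquiv (tup s k)))
  have hH : Function.Injective H := by
    intro s t hst
    have hG : G s = G t := congrArg Prod.fst hst
    have hk : ∀ k, j (G s) ((e s).toEquiv (tup s k)) = j (G t) ((e t).toEquiv (tup t k)) :=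
      fun k => congrFun (congrArg Prod.snd hst) k
    have key : ∀ (q q' : Quotient (countableModelSetoid T)) (hq : q = q')
        (e1 : (mkMod T _ (hmod s)).1 ≃[L] q.out.1) (e2 : (mkMod T _ (hmod t)).1 ≃[L] q'.out.1),
        (∀ k, j q (e1.toEquiv (tup s k)) = j q' (e2.toEquiv (tup t k))) →
        ∃ e3 : (mkMod T _ (hmod s)).1 ≃[L] (mkMod T _ (hmod t)).1, ∀ k, e3.toEquiv (tup s k) = tup t k := by
      rintro q _ rfl e1 e2 h
      refine ⟨e2.symm.comp e1, fun k => ?_⟩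
      have h3 : e1.toEquiv (tup s k) = e2.toEquiv (tup t k) := hj q (h k)
      show e2.toEquiv.symm (e1.toEquiv (tup s k)) = _
      rw [h3]
      exact e2.toEquiv.symm_apply_apply _
    obtain ⟨e3, he3⟩ := key _ _ hG (e s) (e t) hk
    obtain ⟨e4, he4⟩ := iso_up (str s) (str t) e3 (fun a => he3 (Sum.inl a))
    refine h2 s t ⟨e4, fun k => ?_⟩
    rw [he4]
    exact he3 (Sum.inr k)
  obtain ⟨j2, hj2⟩ := exists_injective_nat (A ⊕ K → ℕ)
  have hle := Cardinal.mk_le_of_injective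
    (f := fun x : ULift.{max u v 1} (Set ℕ) =>
      ((H x.down).1, ULift.up.{max u v 1} (j2 (H x.down).2))) (by
    intro x y h
    have h3 : (H x.down).1 = (H y.down).1 := (Prod.ext_iff.1 h).1
    have h4 : j2 (H x.down).2 = j2 (H y.down).2 := congrArg (fun p => (Prod.snd p).down) h
    exact ULift.down_injective (hH (Prod.ext h3 (hj2 h4))))
  rw [Cardinal.mk_prod] at hle
  simp only [mk_uLift, mk_set, mk_nat, lift_two_power, lift_aleph0, lift_id, lift_lift] at hle
  by_contra hn
  have hn := not_le.1 hn
  have := Cardinal.mul_lt_of_lt (cantor ℵ₀).le hn (cantor ℵ₀)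
  exact absurd (hle.trans_lt (by simpa [numCountableModels] using this)) (lt_irrefl _)

end count
end PaperDef

namespace PaperDef

variable {L : FirstOrder.Language.{u, v}}
variable {M : Type w} [L.Structure M]

/-- Theorem 1. If the complete theory `T` (in a countable language,
with infinite models) admits an infinite definable discrete linear order in some
ℵ₀-saturated model, then `T` has exactly `2 ^ ℵ₀` countably infinite models. -/
theorem statement0 (L : FirstOrder.Language.{u, v}) (hL : L.card ≤ ℵ₀)
    (T : L.Theory) (hT : T.IsComplete)
    (M : Type w) [L.Structure M] (hMT : M ⊨ T) (hMinf : Infinite M)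
    (hsat : IsAleph0Saturated L M)
    (n m : ℕ) (hn : 1 ≤ n)
    (δ : L.Formula (Fin n ⊕ Fin m)) (φ : L.Formula ((Fin n ⊕ Fin n) ⊕ Fin m))
    (c : Fin m → M)
    (D : Set (Fin n → M)) (hD : D = {x | δ.Realize (Sum.elim x c)})
    (r : (Fin n → M) → (Fin n → M) → Prop)
    (hr : r = fun x y => φ.Realize (Sum.elim (Sum.elim x y) c))
    (hDinf : D.Infinite)
    (hlin : IsLinearOn r D) (hdisc : IsDiscreteOn r D) :
    numCountableModels T = 2 ^ ℵ₀ := by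
  refine le_antisymm (card_upper hL T) ?_
  obtain ⟨f, hf⟩ := all_good hL δ φ c D hD r hr hDinf hlin hdisc
  exact card_lower T hMT f hf

end PaperDef
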